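/- arXiv:1110.4065 — 4 statements merged into one kernel-verified Lean document; each statement's English description precedes it below -/
import Mathlib

section
/- Let ψ(z) := Γ′(z)/Γ(z) denote the digamma function, the logarithmic derivative of the complex Gamma function Γ. Then there exist sequences (a_j), (b_j), (c_j) of complex numbers such that the function φ₂(t) := ∫_ℝ e^{−tλ²} ψ(1 + iλ) dλ admits the asymptotic expansion φ₂(t) ∼ Σ_{j=0}^∞ a_j t^{j−1/2} + Σ_{j=0}^∞ b_j t^{j−1/2} log t + Σ_{j=0}^∞ c_j t^j as t → 0⁺; precisely, for every N ∈ ℕ there is C_N > 0 such that |φ₂(t) − Σ_{j=0}^N ( a_j t^{j−1/2} + b_j t^{j−1/2} log t + c_j t^j )| ≤ C_N t^{N+1/2} (1 + |log t|) for all t ∈ (0,1]. -/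
open MeasureTheory Real Set

/-- The digamma function `ψ = Γ'/Γ`. -/
noncomputable def digamma (z : ℂ) : ℂ := deriv Complex.Gamma z / Complex.Gamma z

theorem self_div_exp_sub_one_le {u : ℝ} (hu : 0 < u) : u / (exp u - 1) ≤ exp (-(1 / 2) * u) := by
  have h1 : 0 < exp u - 1 := by linarith [add_one_lt_exp hu.ne']
  rw [div_le_iff₀ h1]
  have h2 : u / 2 ≤ sinh (u / 2) := self_le_sinh_iff.2 (by positivity)
  rw [sinh_eq] at h2
  have h3 : exp (-(1 / 2) * u) * (exp u - 1) = exp (u / 2) - exp (-(u / 2)) := by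
    rw [mul_sub, ← exp_add, mul_one]
    ring_nf
  linarith

theorem integrableOn_self_div_exp_sub_one :
    IntegrableOn (fun u : ℝ => u / (exp u - 1)) (Ioi 0) := by
  refine (exp_neg_integrableOn_Ioi 0 (b := 1 / 2) (by norm_num)).mono'
    (Measurable.aestronglyMeasurable (by fun_prop))
    ((ae_restrict_iff' measurableSet_Ioi).2 (.of_forall fun u hu => ?_))
  have hu : 0 < u := hu
  have h1 : 0 < exp u - 1 := by linarith [add_one_lt_exp hu.ne']
  rw [norm_of_nonneg (div_nonneg hu.le h1.le)]
  exact self_div_exp_sub_one_le hu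

/-- `1/(eᵘ - 1) - 1/u`, which is bounded and smooth up to `u = 0`. -/
noncomputable def boseRegular (u : ℝ) : ℝ := (exp u - 1)⁻¹ - u⁻¹

theorem measurable_boseRegular : Measurable boseRegular := by
  unfold boseRegular; fun_prop

theorem abs_boseRegular_le_one {u : ℝ} (hu : 0 < u) : |boseRegular u| ≤ 1 := by
  have h0 := add_one_lt_exp hu.ne'
  have h1 : 0 < exp u - 1 := by linarith
  have h2 : boseRegular u = -((exp u - 1 - u) / (u * (exp u - 1))) := by
    unfold boseRegular; field_simp; ring
  rw [h2, abs_neg, abs_of_nonneg (div_nonneg (by linarith) (by positivity)),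
    div_le_one (by positivity)]
  have h3 := add_one_le_exp (-u)
  have h4 : exp u * exp (-u) = 1 := by rw [← exp_add]; simp
  nlinarith [exp_pos u]

theorem integrableOn_gaussian_mul_of_bounded {a C : ℝ} (ha : 0 < a) {f : ℝ → ℝ} (k : ℕ)
    (hf : AEStronglyMeasurable f (volume.restrict (Ioi 0)))
    (hb : ∀ u : ℝ, 0 < u → |f u| ≤ C * u ^ k) :
    IntegrableOn (fun u : ℝ => exp (-a * u ^ 2) * f u) (Ioi 0) := by
  have h := ((integrable_rpow_mul_exp_neg_mul_sq ha (s := k)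
    (by linarith [(Nat.cast_nonneg k : (0 : ℝ) ≤ k)])).const_mul C).integrableOn (s := Ioi 0)
  refine h.mono' (by fun_prop)
    ((ae_restrict_iff' measurableSet_Ioi).2 (.of_forall fun u hu => ?_))
  rw [norm_mul, norm_of_nonneg (exp_pos _).le, norm_eq_abs, rpow_natCast, ← mul_assoc, mul_comm]
  exact mul_le_mul_of_nonneg_right (hb u hu) (exp_pos _).le

theorem integrableOn_gaussian_mul_boseRegular {a : ℝ} (ha : 0 < a) :
    IntegrableOn (fun u : ℝ => exp (-a * u ^ 2) * boseRegular u) (Ioi 0) :=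
  integrableOn_gaussian_mul_of_bounded (C := 1) ha 0 measurable_boseRegular.aestronglyMeasurable
    fun u hu => by simpa using abs_boseRegular_le_one hu

theorem one_sub_exp_neg_sq_le {y : ℝ} (hy : 0 ≤ y) : 1 - exp (-y ^ 2) ≤ y := by
  rcases le_total y 1 with h | h
  · nlinarith [add_one_le_exp (-y ^ 2)]
  · linarith [exp_pos (-y ^ 2)]

theorem integrableOn_one_sub_gaussian_div {a : ℝ} (ha : 0 < a) :
    IntegrableOn (fun u : ℝ => (1 - exp (-a * u ^ 2)) / (exp u - 1)) (Ioi 0) := by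
  refine (integrableOn_self_div_exp_sub_one.const_mul (√a)).mono'
    (Measurable.aestronglyMeasurable (by fun_prop))
    ((ae_restrict_iff' measurableSet_Ioi).2 (.of_forall fun u hu => ?_))
  have hu : 0 < u := hu
  have h1 : 0 < exp u - 1 := by linarith [add_one_lt_exp hu.ne']
  have h2 := one_sub_exp_neg_sq_le (y := √a * u) (by positivity)
  rw [mul_pow, sq_sqrt ha.le, ← neg_mul] at h2
  have h3 : exp (-a * u ^ 2) ≤ 1 := exp_le_one_iff.2 (by nlinarith [sq_nonneg u])
  rw [norm_of_nonneg (div_nonneg (by linarith) h1.le), ← mul_div_assoc]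
  gcongr

theorem integral_one_sub_gaussian_div {a : ℝ} (ha : 0 < a) :
    ∫ u in Ioi 0, (1 - exp (-a * u ^ 2)) / (exp u - 1) =
      (∫ u in Ioi 0, (1 - exp (-1 * u ^ 2)) / (exp u - 1)) + log a / 2
        + (∫ u in Ioi 0, exp (-1 * u ^ 2) * boseRegular u)
        - ∫ u in Ioi 0, exp (-a * u ^ 2) * boseRegular u := by
  have hJa := integrableOn_one_sub_gaussian_div ha
  have hJ1 := integrableOn_one_sub_gaussian_div one_pos
  have hQa := integrableOn_gaussian_mul_boseRegular ha
  have hQ1 := integrableOn_gaussian_mul_boseRegular one_pos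
  have heq : ∀ u ∈ Ioi (0 : ℝ), u⁻¹ • (exp (-(1 * u) ^ 2) - exp (-(√a * u) ^ 2)) =
      ((1 - exp (-a * u ^ 2)) / (exp u - 1) - (1 - exp (-1 * u ^ 2)) / (exp u - 1)) -
      (exp (-1 * u ^ 2) * boseRegular u - exp (-a * u ^ 2) * boseRegular u) := by
    intro u _
    rw [mul_pow, mul_pow, sq_sqrt ha.le, ← neg_mul, ← neg_mul, one_pow, boseRegular, smul_eq_mul,
      div_eq_mul_inv, div_eq_mul_inv]
    ring
  have hint := ((hJa.sub hJ1).sub (hQ1.sub hQa)).congr_fun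
    (fun u hu => (heq u hu).symm) measurableSet_Ioi
  have hcont : Continuous fun x : ℝ => exp (-x ^ 2) := by fun_prop
  have hF := Frullani.integral_Ioi_eq (f := fun x : ℝ => exp (-x ^ 2)) (a := 1) (b := √a)
    (L := 1) (R := 0) (hcont.locallyIntegrable.locallyIntegrableOn _) one_pos (sqrt_pos.2 ha)
    ((hcont.tendsto' 0 1 (by simp)).mono_left nhdsWithin_le_nhds)
    (tendsto_exp_atBot.comp (Filter.tendsto_neg_atTop_atBot.comp
      (Filter.tendsto_pow_atTop two_ne_zero))) hint
  rw [setIntegral_congr_fun measurableSet_Ioi heq] at hF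
  erw [integral_sub (hJa.sub hJ1) (hQ1.sub hQa), integral_sub hJa hJ1, integral_sub hQ1 hQa] at hF
  rw [div_one, log_sqrt ha.le] at hF
  simp only [sub_zero, smul_eq_mul, mul_one] at hF
  linarith

theorem exists_hasFPowerSeriesAt_boseRegular :
    ∃ (f : ℝ → ℝ) (p : FormalMultilinearSeries ℝ ℝ ℝ), HasFPowerSeriesAt f p 0 ∧
      ∀ u ≠ 0, f u = boseRegular u := by
  obtain ⟨p, hp⟩ := analyticAt_rexp (x := 0)
  have hE : AnalyticAt ℝ (dslope exp 0) 0 := ⟨_, hp.has_fpower_series_dslope_fslope⟩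
  have hE0 : dslope exp 0 0 = 1 := by simp [dslope_same]
  obtain ⟨r, hr⟩ := hE.inv (by simp)
  refine ⟨_, _, hr.has_fpower_series_dslope_fslope, fun u hu => ?_⟩
  have h1 : exp u - 1 ≠ 0 := by simpa [sub_eq_zero] using hu
  rw [dslope_of_ne _ hu, slope_def_field, Pi.inv_apply, Pi.inv_apply, hE0, dslope_of_ne _ hu,
    slope_def_field, boseRegular]
  simp only [sub_zero, exp_zero]
  field_simp

theorem exists_taylor_boseRegular : ∃ β : ℕ → ℝ, ∀ K : ℕ, ∃ C : ℝ, ∀ u : ℝ, 0 < u →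
    |boseRegular u - ∑ k ∈ Finset.range K, β k * u ^ k| ≤ C * u ^ K := by
  obtain ⟨f, p, hp, hf⟩ := exists_hasFPowerSeriesAt_boseRegular
  refine ⟨p.coeff, fun K => ?_⟩
  obtain ⟨C, hC⟩ := (hp.isBigO_sub_partialSum_pow K).bound
  obtain ⟨δ, hδ, hball⟩ := Metric.eventually_nhds_iff.1 hC
  have hsum : ∀ u, p.partialSum K u = ∑ k ∈ Finset.range K, p.coeff k * u ^ k := fun u => by
    simp [FormalMultilinearSeries.partialSum, mul_comm]
  refine ⟨max C ((1 + ∑ k ∈ Finset.range K, |p.coeff k| * δ ^ k) / δ ^ K), fun u hu => ?_⟩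
  rcases lt_or_ge u δ with h | h
  · have := hball (y := u) (by simpa [abs_of_pos hu] using h)
    rw [zero_add, hf u hu.ne', hsum, norm_pow, norm_norm, norm_eq_abs, norm_of_nonneg hu.le] at this
    exact this.trans (by gcongr; exact le_max_left _ _)
  · have h1 : 1 ≤ u / δ := (one_le_div hδ).2 h
    calc |boseRegular u - ∑ k ∈ Finset.range K, p.coeff k * u ^ k|
        ≤ |boseRegular u| + ∑ k ∈ Finset.range K, |p.coeff k * u ^ k| :=
          (abs_sub _ _).trans (by gcongr; exact Finset.abs_sum_le_sum_abs _ _)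
      _ ≤ (u / δ) ^ K + ∑ k ∈ Finset.range K, |p.coeff k| * δ ^ k * (u / δ) ^ K := by
          gcongr with k hk
          · exact (abs_boseRegular_le_one hu).trans (one_le_pow₀ h1)
          · have h2 : (u / δ) ^ k ≤ (u / δ) ^ K :=
              pow_le_pow_right₀ h1 (Finset.mem_range.1 hk).le
            calc |p.coeff k * u ^ k| = |p.coeff k| * δ ^ k * (u / δ) ^ k := by
                  rw [abs_mul, abs_of_pos (pow_pos hu k), div_pow]; field_simp
              _ ≤ _ := by gcongr
      _ = (1 + ∑ k ∈ Finset.range K, |p.coeff k| * δ ^ k) / δ ^ K * u ^ K := by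
          rw [← Finset.sum_mul, div_pow]; field_simp
      _ ≤ _ := by gcongr; exact le_max_right _ _

theorem integral_gaussian_mul_pow_Ioi {a : ℝ} (ha : 0 < a) (k : ℕ) :
    ∫ u in Ioi (0 : ℝ), exp (-a * u ^ 2) * u ^ k =
      a ^ (-((k : ℝ) + 1) / 2) * (1 / 2 * Gamma (((k : ℝ) + 1) / 2)) := by
  have h := integral_rpow_mul_exp_neg_mul_rpow (p := 2) (q := k) two_pos
    (by linarith [(Nat.cast_nonneg k : (0 : ℝ) ≤ k)]) ha
  simpa [mul_comm, mul_assoc, mul_left_comm] using h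

/-- Watson's lemma for the Gaussian integral of `boseRegular`. -/
theorem exists_expansion_integral_gaussian_mul_boseRegular :
    ∃ m : ℕ → ℝ, ∀ K : ℕ, ∃ C : ℝ, ∀ a : ℝ, 0 < a →
      |(∫ u in Ioi 0, exp (-a * u ^ 2) * boseRegular u) -
        ∑ k ∈ Finset.range K, m k * a ^ (-((k : ℝ) + 1) / 2)| ≤
      C * a ^ (-((K : ℝ) + 1) / 2) := by
  obtain ⟨β, hβ⟩ := exists_taylor_boseRegular
  refine ⟨fun k => β k * (1 / 2 * Gamma (((k : ℝ) + 1) / 2)), fun K => ?_⟩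
  obtain ⟨C, hC⟩ := hβ K
  refine ⟨C * (1 / 2 * Gamma (((K : ℝ) + 1) / 2)), fun a ha => ?_⟩
  have hpow : ∀ k : ℕ, IntegrableOn (fun u : ℝ => exp (-a * u ^ 2) * u ^ k) (Ioi 0) := fun k =>
    integrableOn_gaussian_mul_of_bounded (C := 1) ha k (by fun_prop)
      fun u hu => by rw [abs_of_pos (pow_pos hu k), one_mul]
  have hterm : ∀ k ∈ Finset.range K,
      IntegrableOn (fun u : ℝ => β k * (exp (-a * u ^ 2) * u ^ k)) (Ioi 0) :=
    fun k _ => (hpow k).const_mul _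
  have hsum : ∑ k ∈ Finset.range K,
      β k * (1 / 2 * Gamma (((k : ℝ) + 1) / 2)) * a ^ (-((k : ℝ) + 1) / 2) =
      ∫ u in Ioi 0, ∑ k ∈ Finset.range K, β k * (exp (-a * u ^ 2) * u ^ k) := by
    rw [integral_finsetSum _ hterm]
    refine Finset.sum_congr rfl fun k _ => ?_
    rw [integral_const_mul, integral_gaussian_mul_pow_Ioi ha]
    ring
  rw [hsum, ← integral_sub (integrableOn_gaussian_mul_boseRegular ha)
    (integrable_finsetSum _ hterm), ← norm_eq_abs]
  calc _ ≤ ∫ u in Ioi 0, C * (exp (-a * u ^ 2) * u ^ K) := by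
        refine norm_integral_le_of_norm_le ((hpow K).const_mul C)
          ((ae_restrict_iff' measurableSet_Ioi).2 (.of_forall fun u hu => ?_))
        have h1 : exp (-a * u ^ 2) * boseRegular u -
            ∑ k ∈ Finset.range K, β k * (exp (-a * u ^ 2) * u ^ k) =
            exp (-a * u ^ 2) * (boseRegular u - ∑ k ∈ Finset.range K, β k * u ^ k) := by
          rw [mul_sub, Finset.mul_sum]
          congr 1
          exact Finset.sum_congr rfl fun k _ => by ring
        rw [h1, norm_mul, norm_of_nonneg (exp_pos _).le, norm_eq_abs, mul_left_comm]
        exact mul_le_mul_of_nonneg_left (hC u hu) (exp_pos _).le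
    _ = _ := by
        rw [integral_const_mul, integral_gaussian_mul_pow_Ioi ha]
        ring

open Filter Topology in
/-- `ψ(z) - ψ(1)` as a limit of differences of Beta integrals. -/
theorem tendsto_betaIntegral_sub {z : ℂ} (hz : 0 < z.re) :
    Tendsto (fun ε : ℝ => Complex.betaIntegral 1 ε - Complex.betaIntegral z ε) (𝓝[>] 0)
      (𝓝 (digamma z - digamma 1)) := by
  have hinv : ∀ w : ℂ, 0 < w.re → HasDerivAt
      (fun ε : ℝ => Complex.Gamma w / Complex.Gamma (w + ε)) (-digamma w) 0 := by
    intro w hw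
    have hG : DifferentiableAt ℂ Complex.Gamma w :=
      Complex.differentiableAt_Gamma _ fun m h => by
        rw [h] at hw; simp at hw; linarith [(Nat.cast_nonneg m : (0 : ℝ) ≤ m)]
    have hne := Complex.Gamma_ne_zero_of_re_pos hw
    have h1 : HasDerivAt (fun ε : ℝ => Complex.Gamma (w + ε)) (deriv Complex.Gamma w) 0 := by
      have h2 : HasDerivAt (fun ε : ℂ => Complex.Gamma (w + ε)) (deriv Complex.Gamma w)
          ((0 : ℝ) : ℂ) := by
        refine HasDerivAt.comp_const_add w _ ?_
        simpa using hG.hasDerivAt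
      exact h2.comp_ofReal
    have h3 := (h1.inv (by simpa using hne)).const_mul (Complex.Gamma w)
    refine h3.congr_deriv ?_
    simp [digamma]
    field_simp
  have hslope := ((hinv 1 (by simp)).sub (hinv z hz)).tendsto_slope_zero_right
  have hone : Tendsto (fun ε : ℝ => Complex.Gamma (1 + ε)) (𝓝[>] 0) (𝓝 1) := by
    have h1 : ContinuousAt (fun ε : ℝ => Complex.Gamma (1 + ε)) 0 := by
      refine ContinuousAt.comp (g := Complex.Gamma) ?_ (by fun_prop)
      refine (Complex.differentiableAt_Gamma _ fun m h => ?_).continuousAt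
      have := congrArg Complex.re h
      simp at this; linarith [(Nat.cast_nonneg m : (0 : ℝ) ≤ m)]
    have h2 := h1.tendsto.mono_left (nhdsWithin_le_nhds (s := Ioi 0))
    simpa using h2
  have hmul := hone.mul hslope
  rw [one_mul, show -digamma 1 - -digamma z = digamma z - digamma 1 by ring] at hmul
  refine hmul.congr' ?_
  filter_upwards [self_mem_nhdsWithin] with ε hε
  have hε : 0 < ε := hε
  have hε0 : (ε : ℂ) ≠ 0 := by exact_mod_cast hε.ne'
  rw [Complex.betaIntegral_eq_Gamma_mul_div _ _ (by simp) (by simpa using hε),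
    Complex.betaIntegral_eq_Gamma_mul_div _ _ hz (by simpa using hε)]
  have h1 := Complex.Gamma_add_one (ε : ℂ) hε0
  have h2 := Complex.Gamma_ne_zero_of_re_pos hz
  rw [add_comm] at h1
  have h3 : Complex.Gamma ε ≠ 0 := Complex.Gamma_ne_zero_of_re_pos (by simpa using hε)
  simp [h1, h2]
  field_simp

theorem betaIntegral_one_sub {l ε : ℝ} (hε : 0 < ε) :
    Complex.betaIntegral 1 ε - Complex.betaIntegral (1 + Complex.I * l) ε =
      ∫ u in Ioi (0 : ℝ), (((1 - exp (-u)) ^ ε / (exp u - 1) : ℝ) : ℂ) *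
        (1 - Complex.exp (-(Complex.I * l * u))) := by
  have himage : (fun u : ℝ => exp (-u)) '' Ioi 0 = Ioo 0 1 := by
    ext x
    constructor
    · rintro ⟨u, hu, rfl⟩
      exact ⟨exp_pos _, exp_lt_one_iff.2 (neg_neg_of_pos hu)⟩
    · rintro ⟨h0, h1⟩
      exact ⟨-log x, neg_pos.2 (log_neg h0 h1), by simp [exp_log h0]⟩
  have hεre : 0 < (ε : ℂ).re := by simpa using hε
  rw [Complex.betaIntegral, Complex.betaIntegral, ← intervalIntegral.integral_sub
    (Complex.betaIntegral_convergent (by simp) hεre)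
    (Complex.betaIntegral_convergent (by simp) hεre),
    intervalIntegral.integral_of_le zero_le_one, integral_Ioc_eq_integral_Ioo, ← himage,
    integral_image_eq_integral_abs_deriv_smul (f' := fun u => -exp (-u)) measurableSet_Ioi
      (fun u _ => by simpa using (((hasDerivAt_neg u).exp).hasDerivWithinAt))
      (fun u _ v _ h => by simpa using h)]
  refine setIntegral_congr_fun measurableSet_Ioi fun u hu => ?_
  have hu : 0 < u := hu
  have h1 : 0 < 1 - exp (-u) := by linarith [exp_lt_one_iff.2 (neg_neg_of_pos hu)]
  have h2 : ((1 : ℂ) - (exp (-u) : ℝ)) ^ ((ε : ℂ) - 1) =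
      (((1 - exp (-u)) ^ ε / (1 - exp (-u)) : ℝ) : ℂ) := by
    rw [← rpow_sub_one h1.ne', Complex.ofReal_cpow h1.le]
    push_cast; rfl
  have h3 : ((exp (-u) : ℝ) : ℂ) ^ (Complex.I * l) = Complex.exp (-(Complex.I * l * u)) := by
    rw [Complex.cpow_def_of_ne_zero (by exact_mod_cast (exp_pos _).ne'), ← Complex.ofReal_log
      (exp_pos _).le, log_exp]
    push_cast; ring_nf
  have h4 : exp u - 1 = exp u * (1 - exp (-u)) := by
    rw [mul_sub, ← exp_add]; simp
  simp only [sub_self, Complex.cpow_zero, add_sub_cancel_left, one_mul]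
  rw [h2, h3, h4, abs_neg, abs_of_pos (exp_pos _), Complex.real_smul, exp_neg]
  push_cast
  have := Complex.exp_ne_zero u
  field_simp

theorem norm_one_sub_exp_le (l u : ℝ) (hu : 0 ≤ u) :
    ‖1 - Complex.exp (-(Complex.I * l * u))‖ ≤ |l| * u := by
  have h := Real.norm_exp_I_mul_ofReal_sub_one_le (x := -(l * u))
  rw [norm_sub_rev]
  convert h using 1
  · push_cast; ring_nf
  · rw [norm_neg, norm_mul, norm_eq_abs, norm_of_nonneg hu]

open Filter Topology in
/-- Gauss's integral for the digamma function on the line `Re z = 1`. -/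
theorem digamma_one_add_I_mul (l : ℝ) :
    digamma (1 + Complex.I * l) = digamma 1 + ∫ u in Ioi (0 : ℝ),
      (((exp u - 1)⁻¹ : ℝ) : ℂ) * (1 - Complex.exp (-(Complex.I * l * u))) := by
  have h1 := tendsto_betaIntegral_sub (z := 1 + Complex.I * l) (by simp)
  have h2 : Tendsto (fun ε : ℝ => Complex.betaIntegral 1 ε -
      Complex.betaIntegral (1 + Complex.I * l) ε) (𝓝[>] 0) (𝓝 (∫ u in Ioi (0 : ℝ),
      (((exp u - 1)⁻¹ : ℝ) : ℂ) * (1 - Complex.exp (-(Complex.I * l * u))))) := by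
    refine Tendsto.congr' (f₁ := fun ε : ℝ => ∫ u in Ioi (0 : ℝ),
      (((1 - exp (-u)) ^ ε / (exp u - 1) : ℝ) : ℂ) *
        (1 - Complex.exp (-(Complex.I * l * u)))) ?_ ?_
    · filter_upwards [self_mem_nhdsWithin] with ε hε using (betaIntegral_one_sub hε).symm
    refine tendsto_integral_filter_of_dominated_convergence
      (fun u => |l| * (u / (exp u - 1))) ?_ ?_ (integrableOn_self_div_exp_sub_one.const_mul _) ?_
    · exact .of_forall fun ε => Measurable.aestronglyMeasurable (by fun_prop)
    · filter_upwards [self_mem_nhdsWithin] with ε hε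
      refine (ae_restrict_iff' measurableSet_Ioi).2 (.of_forall fun u hu => ?_)
      have hu : 0 < u := hu
      have hε : 0 < ε := hε
      have h1 : 0 < exp u - 1 := by linarith [add_one_lt_exp hu.ne']
      have h2 : 0 < 1 - exp (-u) := by linarith [exp_lt_one_iff.2 (neg_neg_of_pos hu)]
      have h3 : (1 - exp (-u)) ^ ε ≤ 1 := rpow_le_one h2.le (by linarith [exp_pos (-u)]) hε.le
      rw [norm_mul, Complex.norm_real, norm_of_nonneg (by positivity)]
      calc _ ≤ 1 / (exp u - 1) * (|l| * u) := by
            gcongr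
            exact norm_one_sub_exp_le l u hu.le
        _ = _ := by ring
    · refine (ae_restrict_iff' measurableSet_Ioi).2 (.of_forall fun u hu => ?_)
      have hu : 0 < u := hu
      have h2 : 0 < 1 - exp (-u) := by linarith [exp_lt_one_iff.2 (neg_neg_of_pos hu)]
      have h3 : Tendsto (fun ε : ℝ => (1 - exp (-u)) ^ ε / (exp u - 1)) (𝓝[>] 0)
          (𝓝 (exp u - 1)⁻¹) := by
        have h4 : ContinuousAt (fun ε : ℝ => (1 - exp (-u)) ^ ε / (exp u - 1)) 0 :=
          (continuousAt_const_rpow h2.ne').div_const _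
        simpa using h4.tendsto.mono_left (nhdsWithin_le_nhds (s := Ioi 0))
      exact ((Complex.continuous_ofReal.tendsto _).comp h3).mul_const _
  rw [← tendsto_nhds_unique h1 h2]
  ring

theorem integral_gaussian_mul_digamma {t : ℝ} (ht : 0 < t) :
    ∫ l : ℝ, (exp (-t * l ^ 2) : ℂ) * digamma (1 + Complex.I * l) =
      (√(π / t) : ℂ) * (digamma 1 +
        ((∫ u in Ioi 0, (1 - exp (-(4 * t)⁻¹ * u ^ 2)) / (exp u - 1) : ℝ) : ℂ)) := by
  have hgauss : Integrable fun l : ℝ => ((exp (-t * l ^ 2) : ℝ) : ℂ) :=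
    (integrable_exp_neg_mul_sq ht).ofReal
  have hfourier : ∀ u : ℝ, ∫ l : ℝ, ((exp (-t * l ^ 2) : ℝ) : ℂ) *
      Complex.exp (-(Complex.I * l * u)) = ((√(π / t) * exp (-(4 * t)⁻¹ * u ^ 2) : ℝ) : ℂ) := by
    intro u
    have h := fourierIntegral_gaussian (b := t) (by simpa using ht) (-u : ℂ)
    rw [Complex.ofReal_mul, sqrt_eq_rpow, Complex.ofReal_cpow (by positivity)]
    push_cast
    convert h using 3 with l
    · rw [mul_comm]
      ring_nf
    · ring
  have hfourier_int : ∀ u : ℝ, Integrable fun l : ℝ => ((exp (-t * l ^ 2) : ℝ) : ℂ) *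
      Complex.exp (-(Complex.I * l * u)) := fun u => by
    refine hgauss.mono (Measurable.aestronglyMeasurable (by fun_prop)) (.of_forall fun l => ?_)
    rw [norm_mul, show -(Complex.I * l * u) = ((-(l * u) : ℝ) : ℂ) * Complex.I by
      push_cast; ring, Complex.norm_exp_ofReal_mul_I, mul_one]
  set F : ℝ → ℝ → ℂ := fun l u => ((exp (-t * l ^ 2) : ℝ) : ℂ) *
    ((((exp u - 1)⁻¹ : ℝ) : ℂ) * (1 - Complex.exp (-(Complex.I * l * u)))) with hF
  have hFint : Integrable (Function.uncurry F) (volume.prod (volume.restrict (Ioi 0))) := by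
    have habs : Integrable fun l : ℝ => |l| * exp (-t * l ^ 2) := by
      simpa [abs_mul] using (integrable_mul_exp_neg_mul_sq ht).abs
    refine (habs.mul_prod integrableOn_self_div_exp_sub_one).mono'
      (Measurable.aestronglyMeasurable (by fun_prop)) ?_
    have hmem : ∀ᵐ p : ℝ × ℝ ∂volume.prod (volume.restrict (Ioi 0)), p.2 ∈ Ioi (0 : ℝ) :=
      Measure.quasiMeasurePreserving_snd.ae (ae_restrict_mem measurableSet_Ioi)
    filter_upwards [hmem] with p hp
    have hu : 0 < p.2 := hp
    have h1 : 0 < exp p.2 - 1 := by linarith [add_one_lt_exp hu.ne']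
    simp only [Function.uncurry, hF]
    rw [norm_mul, norm_mul, Complex.norm_real, Complex.norm_real, norm_of_nonneg (exp_pos _).le,
      norm_of_nonneg (by positivity)]
    calc _ ≤ exp (-t * p.1 ^ 2) * ((exp p.2 - 1)⁻¹ * (|p.1| * p.2)) := by
          gcongr
          exact norm_one_sub_exp_le _ _ hu.le
      _ = _ := by ring
  have hgauss_val : ∫ l : ℝ, ((exp (-t * l ^ 2) : ℝ) : ℂ) = (√(π / t) : ℂ) := by
    rw [integral_complex_ofReal, integral_gaussian]
  calc ∫ l : ℝ, (exp (-t * l ^ 2) : ℂ) * digamma (1 + Complex.I * l)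
      = ∫ l : ℝ, (((exp (-t * l ^ 2) : ℝ) : ℂ) * digamma 1 + ∫ u in Ioi (0 : ℝ), F l u) := by
        refine integral_congr_ae (.of_forall fun l => ?_)
        simp only [hF, integral_const_mul]
        rw [digamma_one_add_I_mul, mul_add]
    _ = (√(π / t) : ℂ) * digamma 1 + ∫ u in Ioi (0 : ℝ), ∫ l : ℝ, F l u := by
        have hinner : Integrable fun l : ℝ => ∫ u in Ioi (0 : ℝ), F l u :=
          hFint.integral_prod_left
        rw [integral_add (hgauss.mul_const _) hinner, integral_mul_const, hgauss_val, integral_integral_swap hFint]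
    _ = _ := by
        rw [mul_add, ← Complex.ofReal_mul, ← integral_const_mul, ← integral_complex_ofReal]
        congr 1
        refine integral_congr_ae (.of_forall fun u => ?_)
        have h1 : ∀ l : ℝ, F l u = (((exp u - 1)⁻¹ : ℝ) : ℂ) * (((exp (-t * l ^ 2) : ℝ) : ℂ) -
            ((exp (-t * l ^ 2) : ℝ) : ℂ) * Complex.exp (-(Complex.I * l * u))) := fun l => by
          simp only [hF]; ring
        simp only [h1]
        rw [integral_const_mul, integral_sub hgauss (hfourier_int u), hgauss_val, hfourier]
        push_cast
        ring

theorem sum_range_half_integer_powers (A B : ℂ) (d : ℕ → ℂ) {t : ℝ} (N : ℕ) :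
    ∑ j ∈ Finset.range (N + 1),
      ((if j = 0 then A else -d (2 * j - 1)) * ((t ^ ((j : ℝ) - 1 / 2) : ℝ) : ℂ) +
        (if j = 0 then B else 0) * ((t ^ ((j : ℝ) - 1 / 2) : ℝ) : ℂ) * (log t : ℂ) +
        -d (2 * j) * ((t ^ j : ℝ) : ℂ)) =
      (A + B * log t) * ((t ^ (-(1 / 2) : ℝ) : ℝ) : ℂ) -
        ∑ k ∈ Finset.range (2 * N + 1), d k * ((t ^ ((k : ℝ) / 2) : ℝ) : ℂ) := by
  induction N with
  | zero => simp; ring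
  | succ N ih =>
    rw [Finset.sum_range_succ, ih, show 2 * (N + 1) + 1 = 2 * N + 1 + 1 + 1 by ring,
      Finset.sum_range_succ _ (2 * N + 1 + 1), Finset.sum_range_succ _ (2 * N + 1)]
    have h1 : (((2 * N + 1 : ℕ) : ℝ) / 2) = ((N + 1 : ℕ) : ℝ) - 1 / 2 := by push_cast; ring
    have h2 : (((2 * N + 1 + 1 : ℕ) : ℝ) / 2) = ((N + 1 : ℕ) : ℝ) := by push_cast; ring
    rw [h1, h2, rpow_natCast, show 2 * (N + 1) - 1 = 2 * N + 1 by omega,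
      show 2 * (N + 1) = 2 * N + 1 + 1 by ring]
    simp only [Nat.add_eq_zero_iff, one_ne_zero, and_false, if_false]
    ring

theorem sqrt_div_mul_rpow {t : ℝ} (ht : 0 < t) (s : ℝ) :
    √(π / t) * ((4 * t)⁻¹) ^ (-(s + 1) / 2) = √π * 4 ^ ((s + 1) / 2) * t ^ (s / 2) := by
  rw [inv_rpow (by positivity), neg_div, rpow_neg (by positivity), inv_inv,
    mul_rpow (by norm_num) ht.le, sqrt_div' _ ht.le, show (s + 1) / 2 = s / 2 + 1 / 2 by ring,
    rpow_add ht, ← sqrt_eq_rpow t]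
  have := sqrt_pos.2 ht
  field_simp

/-- Lemma `Lemas2`: `φ₂(t) = ∫_ℝ e^{-tλ²} ψ(1+iλ) dλ` admits an asymptotic expansion
`Σ a_j t^{j-1/2} + Σ b_j t^{j-1/2} log t + Σ c_j t^j` as `t → 0⁺`. -/
theorem stmt4 :
    ∃ a b c : ℕ → ℂ, ∀ N : ℕ, ∃ C : ℝ, 0 < C ∧ ∀ t ∈ Set.Ioc (0:ℝ) 1,
      ‖(∫ l : ℝ, (Real.exp (-t * l ^ 2) : ℂ) * digamma (1 + Complex.I * l)) -
        ∑ j ∈ Finset.range (N + 1),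
          (a j * ((t ^ ((j : ℝ) - 1/2) : ℝ) : ℂ) +
            b j * ((t ^ ((j : ℝ) - 1/2) : ℝ) : ℂ) * (Real.log t : ℂ) +
            c j * ((t ^ j : ℝ) : ℂ))‖ ≤
      C * t ^ ((N : ℝ) + 1/2) * (1 + |Real.log t|) := by
  obtain ⟨m, hm⟩ := exists_expansion_integral_gaussian_mul_boseRegular
  set J : ℝ := ∫ u in Ioi 0, (1 - exp (-1 * u ^ 2)) / (exp u - 1)
  set Q : ℝ → ℝ := fun a => ∫ u in Ioi 0, exp (-a * u ^ 2) * boseRegular u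
  set d : ℕ → ℝ := fun k => m k * (√π * 4 ^ (((k : ℝ) + 1) / 2)) with hd
  refine ⟨fun j => if j = 0 then (√π : ℂ) * (digamma 1 + J + Q 1 - (log 4 : ℝ) / 2)
      else -(d (2 * j - 1) : ℂ), fun j => if j = 0 then -(√π : ℂ) / 2 else 0,
    fun j => -(d (2 * j) : ℂ), fun N => ?_⟩
  obtain ⟨C, hC⟩ := hm (2 * N + 1)
  set D : ℝ := C * (√π * 4 ^ ((((2 * N + 1 : ℕ) : ℝ) + 1) / 2)) with hD
  refine ⟨|D| + 1, by positivity, fun t ⟨ht, _⟩ => ?_⟩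
  have ha : 0 < (4 * t)⁻¹ := by positivity
  have hsqrt : √(π / t) = √π * t ^ (-(1 / 2) : ℝ) := by
    rw [sqrt_div' _ ht.le, rpow_neg ht.le, ← sqrt_eq_rpow, div_eq_mul_inv]
  have hlog : log (4 * t)⁻¹ = -(log 4 + log t) := by
    rw [log_inv, log_mul (by norm_num) ht.ne']
  have hmain : (∫ l : ℝ, (Real.exp (-t * l ^ 2) : ℂ) * digamma (1 + Complex.I * l)) -
      (((√π : ℂ) * (digamma 1 + J + Q 1 - (log 4 : ℝ) / 2) + -(√π : ℂ) / 2 * log t) *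
        ((t ^ (-(1 / 2) : ℝ) : ℝ) : ℂ) -
        ∑ k ∈ Finset.range (2 * N + 1), (d k : ℂ) * ((t ^ ((k : ℝ) / 2) : ℝ) : ℂ)) =
      ((-(√(π / t) * (Q (4 * t)⁻¹ - ∑ k ∈ Finset.range (2 * N + 1),
        m k * ((4 * t)⁻¹) ^ (-((k : ℝ) + 1) / 2))) : ℝ) : ℂ) := by
    have hsum : √(π / t) * ∑ k ∈ Finset.range (2 * N + 1),
        m k * ((4 * t)⁻¹) ^ (-((k : ℝ) + 1) / 2) =
        ∑ k ∈ Finset.range (2 * N + 1), d k * t ^ ((k : ℝ) / 2) := by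
      rw [Finset.mul_sum]
      refine Finset.sum_congr rfl fun k _ => ?_
      rw [mul_left_comm, sqrt_div_mul_rpow ht]
      simp only [hd]
      ring
    rw [integral_gaussian_mul_digamma ht, integral_one_sub_gaussian_div ha,
      mul_sub (√(π / t)), hsum, hlog, hsqrt]
    push_cast
    ring
  rw [sum_range_half_integer_powers _ _ (fun k => (d k : ℂ)), hmain, Complex.norm_real, norm_neg,
    norm_mul, norm_of_nonneg (sqrt_nonneg _), norm_eq_abs]
  have hexp : ((2 * N + 1 : ℕ) : ℝ) / 2 = (N : ℝ) + 1 / 2 := by push_cast; ring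
  calc _ ≤ √(π / t) * (C * ((4 * t)⁻¹) ^ (-(((2 * N + 1 : ℕ) : ℝ) + 1) / 2)) := by
        gcongr
        exact hC _ ha
    _ = D * t ^ ((N : ℝ) + 1 / 2) := by
        rw [mul_left_comm, sqrt_div_mul_rpow ht, hexp, hD]
        ring
    _ ≤ (|D| + 1) * t ^ ((N : ℝ) + 1 / 2) * 1 := by
        rw [mul_one]
        gcongr
        linarith [le_abs_self D]
    _ ≤ _ := by
        gcongr
        linarith [abs_nonneg (log t)]
end

section
/- Let c > 0 and j > 0. For s ∈ ℂ with Re(s) > 0 the integral Z(s) := (j/π) ∫₀^∞ t^{s−1} e^{−tc²} ( ∫_ℝ e^{−tλ²}/(λ² + j²) dλ ) dt converges absolutely. Moreover there exists a holomorphic function g on the half-plane {s ∈ ℂ : Re(s) > −1/2} such that Γ(s) g(s) = Z(s) for all s with Re(s) > 0, and g(0) = 1 and g′(0) = −2 log(c + j). -/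
open MeasureTheory Real Set
open Filter Topology

theorem integrable_rpow_sq_add_div_sq_add {c j a : ℝ} (hc : c ≠ 0) (hj : j ≠ 0) (ha : a < 1 / 2) :
    Integrable fun l : ℝ => (c ^ 2 + l ^ 2) ^ a / (l ^ 2 + j ^ 2) := by
  have hj2 : 0 < j ^ 2 := by positivity
  have hc2 : 0 < c ^ 2 := by positivity
  have nonneg_case : ∀ b : ℝ, 0 ≤ b → b < 1 / 2 →
      Integrable fun l : ℝ => (c ^ 2 + l ^ 2) ^ b / (l ^ 2 + j ^ 2) := by
    intro b hb0 hb
    have hint := integrable_rpow_neg_one_add_norm_sq (E := ℝ) (μ := volume) (r := 2 - 2 * b)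
      (by simp; linarith)
    refine (hint.const_mul ((1 + c ^ 2) ^ b * (1 + 1 / j ^ 2))).mono'
      (Measurable.aestronglyMeasurable (by fun_prop)) (.of_forall fun l => ?_)
    have hl : 0 < 1 + l ^ 2 := by positivity
    rw [Real.norm_of_nonneg (by positivity), Real.norm_eq_abs, sq_abs,
      show -(2 - 2 * b) / 2 = b - 1 by ring, Real.rpow_sub_one hl.ne']
    have h₁ : (c ^ 2 + l ^ 2) ^ b ≤ (1 + c ^ 2) ^ b * (1 + l ^ 2) ^ b := by
      rw [← Real.mul_rpow (by positivity) (by positivity)]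
      exact Real.rpow_le_rpow (by positivity) (by nlinarith [sq_nonneg (c * l)]) hb0
    have h₂ : 1 / (l ^ 2 + j ^ 2) ≤ (1 + 1 / j ^ 2) / (1 + l ^ 2) := by
      rw [div_le_div_iff₀ (by positivity) hl]
      have : (1 + 1 / j ^ 2) * (l ^ 2 + j ^ 2) = l ^ 2 + j ^ 2 + l ^ 2 / j ^ 2 + 1 := by
        field_simp; ring
      have : 0 ≤ l ^ 2 / j ^ 2 := by positivity
      linarith
    calc (c ^ 2 + l ^ 2) ^ b / (l ^ 2 + j ^ 2)
        = (c ^ 2 + l ^ 2) ^ b * (1 / (l ^ 2 + j ^ 2)) := by ring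
      _ ≤ ((1 + c ^ 2) ^ b * (1 + l ^ 2) ^ b) * ((1 + 1 / j ^ 2) / (1 + l ^ 2)) := by gcongr
      _ = _ := by ring
  rcases le_or_gt 0 a with h | h
  · exact nonneg_case a h ha
  · refine ((nonneg_case 0 le_rfl (by norm_num)).const_mul ((c ^ 2) ^ a)).mono'
      (Measurable.aestronglyMeasurable (by fun_prop)) (.of_forall fun l => ?_)
    rw [Real.norm_of_nonneg (by positivity), Real.rpow_zero, mul_one_div]
    refine div_le_div_of_nonneg_right ?_ (by positivity)
    exact Real.rpow_le_rpow_of_nonpos hc2 (le_add_of_nonneg_right (sq_nonneg l)) h.le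

theorem integrable_one_div_sq_add_sq {j : ℝ} (hj : j ≠ 0) :
    Integrable fun l : ℝ => 1 / (l ^ 2 + j ^ 2) := by
  simpa using integrable_rpow_sq_add_div_sq_add (a := 0) one_ne_zero hj (by norm_num)

theorem abs_log_le_rpow_add_rpow {x δ : ℝ} (hx : 0 < x) (hδ : 0 < δ) :
    |Real.log x| ≤ (x ^ δ + x ^ (-δ)) / δ := by
  have h₁ := Real.log_le_rpow_div hx.le hδ
  have h₂ := Real.log_le_rpow_div (inv_pos.2 hx).le hδ
  rw [Real.log_inv, Real.inv_rpow hx.le, ← Real.rpow_neg hx.le] at h₂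
  have h₃ : 0 ≤ x ^ δ / δ := by positivity
  have h₄ : 0 ≤ x ^ (-δ) / δ := by positivity
  rw [add_div, abs_le]
  constructor <;> linarith

theorem integrable_log_sq_add_div_sq_add {c j : ℝ} (hc : c ≠ 0) (hj : j ≠ 0) :
    Integrable fun l : ℝ => Real.log (c ^ 2 + l ^ 2) / (l ^ 2 + j ^ 2) := by
  have h := ((integrable_rpow_sq_add_div_sq_add (a := 1 / 4) hc hj (by norm_num)).add
    (integrable_rpow_sq_add_div_sq_add (a := -(1 / 4)) hc hj (by norm_num))).div_const (1 / 4)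
  refine h.mono' (Measurable.aestronglyMeasurable (by fun_prop)) (.of_forall fun l => ?_)
  have hl : 0 < l ^ 2 + j ^ 2 := by positivity
  rw [norm_div, Real.norm_of_nonneg hl.le, Real.norm_eq_abs]
  have := abs_log_le_rpow_add_rpow (x := c ^ 2 + l ^ 2) (δ := 1 / 4) (by positivity) (by norm_num)
  calc _ ≤ ((c ^ 2 + l ^ 2) ^ (1 / 4 : ℝ) + (c ^ 2 + l ^ 2) ^ (-(1 / 4) : ℝ)) / (1 / 4)
        / (l ^ 2 + j ^ 2) := by gcongr
    _ = _ := by simp only [Pi.add_apply]; ring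

theorem hasDerivAt_arctan_div {j : ℝ} (hj : j ≠ 0) (l : ℝ) :
    HasDerivAt (fun l => Real.arctan (l / j)) (j / (l ^ 2 + j ^ 2)) l := by
  have hl : l ^ 2 + j ^ 2 ≠ 0 := by positivity
  convert ((hasDerivAt_id' l).div_const j).arctan using 1
  field_simp
  ring

theorem tendsto_arctan_div_atTop {j : ℝ} (hj : 0 < j) :
    Tendsto (fun l => Real.arctan (l / j)) atTop (𝓝 (π / 2)) :=
  (tendsto_nhds_of_tendsto_nhdsWithin Real.tendsto_arctan_atTop).comp
    (tendsto_id.atTop_div_const hj)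

theorem tendsto_arctan_div_atBot {j : ℝ} (hj : 0 < j) :
    Tendsto (fun l => Real.arctan (l / j)) atBot (𝓝 (-(π / 2))) :=
  (tendsto_nhds_of_tendsto_nhdsWithin Real.tendsto_arctan_atBot).comp
    (tendsto_id.atBot_div_const hj)

theorem integral_one_div_sq_add_sq {j : ℝ} (hj : 0 < j) :
    ∫ l : ℝ, 1 / (l ^ 2 + j ^ 2) = π / j := by
  have h := integral_of_hasDerivAt_of_tendsto (f' := fun l => j / (l ^ 2 + j ^ 2))
    (hasDerivAt_arctan_div hj.ne')
    (by simpa [div_eq_mul_inv] using (integrable_one_div_sq_add_sq hj.ne').const_mul j)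
    (tendsto_arctan_div_atBot hj) (tendsto_arctan_div_atTop hj)
  simp_rw [← mul_one_div j] at h
  rw [integral_const_mul] at h
  rw [eq_div_iff hj.ne', mul_comm, h]
  ring

theorem integrable_one_div_sq_add_sq_mul {c j : ℝ} (hc : c ≠ 0) (hj : j ≠ 0) :
    Integrable fun l : ℝ => 1 / (c ^ 2 + l ^ 2) / (l ^ 2 + j ^ 2) := by
  have := integrable_rpow_sq_add_div_sq_add (a := -1) hc hj (by norm_num)
  simpa [Real.rpow_neg_one] using this

theorem tendsto_div_sq_add_sq_cocompact (j : ℝ) :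
    Tendsto (fun l : ℝ => l / (l ^ 2 + j ^ 2)) (cocompact ℝ) (𝓝 0) := by
  refine squeeze_zero_norm (a := fun l => ‖l⁻¹‖) (fun l => ?_) ?_
  · rcases eq_or_ne l 0 with rfl | hl
    · simp
    · rw [Real.norm_eq_abs, Real.norm_eq_abs, abs_div, abs_inv, inv_eq_one_div,
        div_le_div_iff₀ (by positivity) (by positivity),
        abs_of_nonneg (by positivity : 0 ≤ l ^ 2 + j ^ 2), ← sq, sq_abs]
      nlinarith [sq_nonneg j]
  · simpa using (tendsto_inv₀_cobounded (α := ℝ)).norm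

theorem integral_one_div_sq_add_sq_mul {c j : ℝ} (hc : 0 < c) (hj : 0 < j) :
    ∫ l : ℝ, 1 / (c ^ 2 + l ^ 2) / (l ^ 2 + j ^ 2) = π / (c * j * (c + j)) := by
  rcases eq_or_ne c j with rfl | hne
  · have hderiv : ∀ l : ℝ, HasDerivAt
        (fun l => 1 / (2 * c ^ 2) * (l / (l ^ 2 + c ^ 2)) + 1 / (2 * c ^ 3) * Real.arctan (l / c))
        (1 / (c ^ 2 + l ^ 2) / (l ^ 2 + c ^ 2)) l := by
      intro l
      have hl : l ^ 2 + c ^ 2 ≠ 0 := by positivity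
      have hl' : c ^ 2 + l ^ 2 ≠ 0 := by positivity
      refine ((((hasDerivAt_id' l).div ((hasDerivAt_pow 2 l).add_const (c ^ 2)) hl).const_mul
        (1 / (2 * c ^ 2))).add ((hasDerivAt_arctan_div hc.ne' l).const_mul
          (1 / (2 * c ^ 3)))).congr_deriv ?_
      rw [add_comm (c ^ 2)]
      field_simp
      ring
    have h0 := tendsto_div_sq_add_sq_cocompact c
    rw [cocompact_eq_atBot_atTop, tendsto_sup] at h0
    rw [integral_of_hasDerivAt_of_tendsto hderiv (integrable_one_div_sq_add_sq_mul hc.ne' hc.ne')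
      ((h0.1.const_mul _).add ((tendsto_arctan_div_atBot hc).const_mul _))
      ((h0.2.const_mul _).add ((tendsto_arctan_div_atTop hc).const_mul _))]
    field_simp
    ring
  · have hsub : c ^ 2 - j ^ 2 ≠ 0 := by
      rw [sq_sub_sq]
      exact mul_ne_zero (by positivity) (sub_ne_zero.2 hne)
    have heq : ∀ l : ℝ, 1 / (c ^ 2 + l ^ 2) / (l ^ 2 + j ^ 2) =
        1 / (c ^ 2 - j ^ 2) * (1 / (l ^ 2 + j ^ 2) - 1 / (l ^ 2 + c ^ 2)) := by
      intro l
      have h₁ : l ^ 2 + j ^ 2 ≠ 0 := by positivity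
      have h₂ : l ^ 2 + c ^ 2 ≠ 0 := by positivity
      rw [add_comm (c ^ 2)]
      field_simp
      ring
    simp_rw [heq]
    rw [integral_const_mul, integral_sub (integrable_one_div_sq_add_sq hj.ne')
      (integrable_one_div_sq_add_sq hc.ne'), integral_one_div_sq_add_sq hj,
      integral_one_div_sq_add_sq hc]
    field_simp
    ring

theorem hasDerivAt_integral_log_sq_add {c j : ℝ} (hc : 0 < c) (hj : 0 < j) :
    HasDerivAt (fun x : ℝ => ∫ l : ℝ, Real.log (x ^ 2 + l ^ 2) / (l ^ 2 + j ^ 2))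
      (2 * π / (j * (c + j))) c := by
  have h := (hasDerivAt_integral_of_dominated_loc_of_deriv_le (μ := volume)
    (F := fun x l : ℝ => Real.log (x ^ 2 + l ^ 2) / (l ^ 2 + j ^ 2))
    (F' := fun x l : ℝ => 2 * x / (x ^ 2 + l ^ 2) / (l ^ 2 + j ^ 2))
    (bound := fun l => 4 / c * (1 / (l ^ 2 + j ^ 2)))
    (Ioi_mem_nhds (half_lt_self hc)) (.of_forall fun x => Measurable.aestronglyMeasurable (by fun_prop))
    (integrable_log_sq_add_div_sq_add hc.ne' hj.ne') (Measurable.aestronglyMeasurable (by fun_prop))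
    (.of_forall fun l x hx => ?_) ((integrable_one_div_sq_add_sq hj.ne').const_mul _)
    (.of_forall fun l x hx => ?_)).2
  · refine h.congr_deriv ?_
    have : ∀ l : ℝ, 2 * c / (c ^ 2 + l ^ 2) / (l ^ 2 + j ^ 2) =
        2 * c * (1 / (c ^ 2 + l ^ 2) / (l ^ 2 + j ^ 2)) := fun l => by ring
    simp_rw [this]
    rw [integral_const_mul, integral_one_div_sq_add_sq_mul hc hj]
    field_simp
  · have hx0 : c / 2 < x := hx
    have hx : 0 < x := by linarith
    have hl : 0 < l ^ 2 + j ^ 2 := by positivity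
    rw [Real.norm_of_nonneg (by positivity), div_eq_mul_one_div]
    refine mul_le_mul_of_nonneg_right ?_ (by positivity)
    rw [div_le_div_iff₀ (by positivity) hc]
    nlinarith [sq_nonneg l, mul_pos hx hc]
  · have hx0 : c / 2 < x := hx
    have hx : 0 < x := by linarith
    have := (((hasDerivAt_pow 2 x).add_const (l ^ 2)).log (by positivity)).div_const (l ^ 2 + j ^ 2)
    simpa using this

theorem tendsto_integral_log_one_add_sq_div {j : ℝ} (hj : 0 < j) :
    Tendsto (fun x : ℝ => ∫ l : ℝ, Real.log (1 + l ^ 2 / x ^ 2) / (l ^ 2 + j ^ 2))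
      atTop (𝓝 0) := by
  have h := tendsto_integral_filter_of_dominated_convergence (μ := volume) (l := atTop)
    (F := fun x l : ℝ => Real.log (1 + l ^ 2 / x ^ 2) / (l ^ 2 + j ^ 2)) (f := fun _ => 0)
    (fun l => Real.log (1 ^ 2 + l ^ 2) / (l ^ 2 + j ^ 2))
    (.of_forall fun x => Measurable.aestronglyMeasurable (by fun_prop)) ?_
    (integrable_log_sq_add_div_sq_add one_ne_zero hj.ne')
    (.of_forall fun l => ?_)
  · simpa using h
  · filter_upwards [eventually_ge_atTop 1] with x hx
    refine .of_forall fun l => ?_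
    have h1 : 0 ≤ l ^ 2 / x ^ 2 := by positivity
    have h2 : l ^ 2 / x ^ 2 ≤ l ^ 2 := div_le_self (sq_nonneg l) (one_le_pow₀ hx)
    have h3 := Real.log_nonneg (show 1 ≤ 1 + l ^ 2 / x ^ 2 by linarith)
    rw [Real.norm_of_nonneg (by positivity), one_pow]
    gcongr
  · have h1 : Tendsto (fun x : ℝ => 1 + l ^ 2 / x ^ 2) atTop (𝓝 1) := by
      simpa using (tendsto_const_nhds (x := (1 : ℝ))).add
        ((tendsto_const_nhds (x := l ^ 2)).div_atTop (tendsto_pow_atTop two_ne_zero))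
    simpa using (h1.log one_ne_zero).div_const (l ^ 2 + j ^ 2)

theorem integral_log_sq_add_div_sq_add {c j : ℝ} (hc : 0 < c) (hj : 0 < j) :
    ∫ l : ℝ, Real.log (c ^ 2 + l ^ 2) / (l ^ 2 + j ^ 2) = 2 * π / j * Real.log (c + j) := by
  set H : ℝ → ℝ := fun x => (∫ l : ℝ, Real.log (x ^ 2 + l ^ 2) / (l ^ 2 + j ^ 2)) -
    2 * π / j * Real.log (x + j) with hH
  have hderiv : ∀ x ∈ Ioi (0 : ℝ), HasDerivAt H 0 x := by
    intro x hx
    have hx : 0 < x := hx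
    refine ((hasDerivAt_integral_log_sq_add hx hj).sub ((((hasDerivAt_id' x).add_const j).log
      (by positivity)).const_mul (2 * π / j))).congr_deriv ?_
    field_simp
    ring
  have hconst : ∀ x ∈ Ioi (0 : ℝ), H x = H c := fun x hx =>
    isOpen_Ioi.is_const_of_deriv_eq_zero isPreconnected_Ioi
      (fun y hy => (hderiv y hy).differentiableAt.differentiableWithinAt)
      (fun y hy => (hderiv y hy).deriv) hx hc
  have hsplit : ∀ x ∈ Ioi (0 : ℝ), H x =
      (∫ l : ℝ, Real.log (1 + l ^ 2 / x ^ 2) / (l ^ 2 + j ^ 2)) -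
        2 * π / j * Real.log (1 + j / x) := by
    intro x hx
    have hx : 0 < x := hx
    have h1 : ∀ l : ℝ, Real.log (1 + l ^ 2 / x ^ 2) / (l ^ 2 + j ^ 2) =
        Real.log (x ^ 2 + l ^ 2) / (l ^ 2 + j ^ 2) -
          2 * Real.log x * (1 / (l ^ 2 + j ^ 2)) := by
      intro l
      rw [show 1 + l ^ 2 / x ^ 2 = (x ^ 2 + l ^ 2) / x ^ 2 by field_simp,
        Real.log_div (by positivity) (by positivity), Real.log_pow]
      push_cast
      ring
    simp_rw [h1]
    rw [integral_sub (integrable_log_sq_add_div_sq_add hx.ne' hj.ne')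
      ((integrable_one_div_sq_add_sq hj.ne').const_mul _), integral_const_mul,
      integral_one_div_sq_add_sq hj, show 1 + j / x = (x + j) / x by field_simp,
      Real.log_div (by positivity) hx.ne']
    simp only [hH]
    ring
  have hlim : Tendsto H atTop (𝓝 0) := by
    have h1 : Tendsto (fun x : ℝ => 1 + j / x) atTop (𝓝 1) := by
      simpa using (tendsto_const_nhds (x := (1 : ℝ))).add
        ((tendsto_const_nhds (x := j)).div_atTop tendsto_id)
    have h2 := (tendsto_integral_log_one_add_sq_div hj).sub
      ((h1.log one_ne_zero).const_mul (2 * π / j))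
    rw [Real.log_one, mul_zero, sub_zero] at h2
    exact h2.congr' ((eventually_gt_atTop 0).mono fun x hx => (hsplit x hx).symm)
  have hlim' : Tendsto H atTop (𝓝 (H c)) :=
    tendsto_const_nhds.congr' ((eventually_gt_atTop 0).mono fun x hx => (hconst x hx).symm)
  exact sub_eq_zero.1 (tendsto_nhds_unique hlim' hlim)

theorem rpow_le_rpow_add_rpow {x p q r : ℝ} (hx : 0 < x) (hpq : p ≤ q) (hqr : q ≤ r) :
    x ^ q ≤ x ^ p + x ^ r := by
  have hp := Real.rpow_pos_of_pos hx p
  have hr := Real.rpow_pos_of_pos hx r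
  rcases le_total x 1 with h | h
  · linarith [Real.rpow_le_rpow_of_exponent_ge hx h hpq]
  · linarith [Real.rpow_le_rpow_of_exponent_le h hqr]

theorem hasDerivAt_integral_cpow_sq_add_div_sq_add {c j : ℝ} (hc : c ≠ 0) (hj : j ≠ 0) {s₀ : ℂ}
    (hs : -1 / 2 < s₀.re) :
    HasDerivAt (fun s : ℂ => ∫ l : ℝ, ((c ^ 2 + l ^ 2 : ℝ) : ℂ) ^ (-s) / ((l ^ 2 + j ^ 2 : ℝ) : ℂ))
      (∫ l : ℝ, -((Real.log (c ^ 2 + l ^ 2) : ℝ) : ℂ) * ((c ^ 2 + l ^ 2 : ℝ) : ℂ) ^ (-s₀) /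
        ((l ^ 2 + j ^ 2 : ℝ) : ℂ)) s₀ := by
  set ε : ℝ := (s₀.re + 1 / 2) / 4 with hε
  have hε0 : 0 < ε := by rw [hε]; linarith
  have hpos : ∀ l : ℝ, 0 < c ^ 2 + l ^ 2 := fun l => by positivity
  have hposj : ∀ l : ℝ, 0 < l ^ 2 + j ^ 2 := fun l => by positivity
  have hint : ∀ a : ℝ, a < 1 / 2 →
      Integrable fun l : ℝ => (c ^ 2 + l ^ 2) ^ a / (l ^ 2 + j ^ 2) :=
    fun a ha => integrable_rpow_sq_add_div_sq_add hc hj ha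
  refine (hasDerivAt_integral_of_dominated_loc_of_deriv_le (μ := volume)
    (F := fun (s : ℂ) (l : ℝ) =>
      ((c ^ 2 + l ^ 2 : ℝ) : ℂ) ^ (-s) / ((l ^ 2 + j ^ 2 : ℝ) : ℂ))
    (F' := fun (s : ℂ) (l : ℝ) =>
      -((Real.log (c ^ 2 + l ^ 2) : ℝ) : ℂ) * ((c ^ 2 + l ^ 2 : ℝ) : ℂ) ^ (-s) /
        ((l ^ 2 + j ^ 2 : ℝ) : ℂ))
    (bound := fun l => ((c ^ 2 + l ^ 2) ^ (-s₀.re + 2 * ε) / (l ^ 2 + j ^ 2) +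
      2 * ((c ^ 2 + l ^ 2) ^ (-s₀.re) / (l ^ 2 + j ^ 2)) +
      (c ^ 2 + l ^ 2) ^ (-s₀.re - 2 * ε) / (l ^ 2 + j ^ 2)) / ε)
    (Metric.ball_mem_nhds s₀ hε0)
    (.of_forall fun x => Measurable.aestronglyMeasurable (by fun_prop)) ?_
    (Measurable.aestronglyMeasurable (by fun_prop)) (.of_forall fun l s hs' => ?_) ?_
    (.of_forall fun l s hs' => ?_)).2
  · refine (hint (-s₀.re) (by linarith)).mono' (Measurable.aestronglyMeasurable (by fun_prop))
      (.of_forall fun l => ?_)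
    rw [norm_div, Complex.norm_cpow_eq_rpow_re_of_pos (hpos l), Complex.norm_of_nonneg (hposj l).le,
      Complex.neg_re]
  · have hre : |s.re - s₀.re| < ε := by
      rw [Metric.mem_ball, dist_eq_norm] at hs'
      simpa using (Complex.abs_re_le_norm (s - s₀)).trans_lt hs'
    obtain ⟨h₁, h₂⟩ := abs_lt.1 hre
    rw [norm_div, norm_mul, Complex.norm_cpow_eq_rpow_re_of_pos (hpos l),
      Complex.norm_of_nonneg (hposj l).le, Complex.neg_re, norm_neg, Complex.norm_real,
      Real.norm_eq_abs]
    set x := c ^ 2 + l ^ 2 with hx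
    have hx0 : 0 < x := hpos l
    have hlog := abs_log_le_rpow_add_rpow hx0 hε0
    have hpow : x ^ (-s.re) ≤ x ^ (-s₀.re - ε) + x ^ (-s₀.re + ε) :=
      rpow_le_rpow_add_rpow hx0 (by linarith) (by linarith)
    have e₁ : x ^ (-s₀.re + 2 * ε) = x ^ ε * x ^ (-s₀.re + ε) := by
      rw [← Real.rpow_add hx0]; ring_nf
    have e₂ : x ^ (-s₀.re) = x ^ ε * x ^ (-s₀.re - ε) := by
      rw [← Real.rpow_add hx0]; ring_nf
    have e₃ : x ^ (-s₀.re) = x ^ (-ε) * x ^ (-s₀.re + ε) := by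
      rw [← Real.rpow_add hx0]; ring_nf
    have e₄ : x ^ (-s₀.re - 2 * ε) = x ^ (-ε) * x ^ (-s₀.re - ε) := by
      rw [← Real.rpow_add hx0]; ring_nf
    have hw := hposj l
    calc |Real.log x| * x ^ (-s.re) / (l ^ 2 + j ^ 2)
        ≤ ((x ^ ε + x ^ (-ε)) / ε) * (x ^ (-s₀.re - ε) + x ^ (-s₀.re + ε)) / (l ^ 2 + j ^ 2) := by
          gcongr
      _ = (x ^ ε * x ^ (-s₀.re + ε) + (x ^ ε * x ^ (-s₀.re - ε) + x ^ (-ε) * x ^ (-s₀.re + ε)) +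
            x ^ (-ε) * x ^ (-s₀.re - ε)) / (l ^ 2 + j ^ 2) / ε := by ring
      _ = _ := by rw [← e₁, ← e₂, ← e₃, ← e₄]; ring
  · exact (((hint _ (by linarith)).add ((hint _ (by linarith)).const_mul 2)).add
      (hint _ (by linarith))).div_const ε
  · have hne : ((c ^ 2 + l ^ 2 : ℝ) : ℂ) ≠ 0 := Complex.ofReal_ne_zero.2 (hpos l).ne'
    refine (((hasDerivAt_neg' s).const_cpow (Or.inl hne)).div_const _).congr_deriv ?_
    rw [Complex.ofReal_log (hpos l).le]
    ring

theorem integrable_cpow_mul_exp_mul_exp_div_prod {c j : ℝ} (hc : c ≠ 0) (hj : j ≠ 0) {s : ℂ}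
    (hs : 0 < s.re) :
    Integrable (fun p : ℝ × ℝ => (p.1 : ℂ) ^ (s - 1) * (Real.exp (-p.1 * c ^ 2) : ℂ) *
      ((Real.exp (-p.1 * p.2 ^ 2) : ℂ) / ((p.2 : ℂ) ^ 2 + (j : ℂ) ^ 2)))
      ((volume.restrict (Ioi 0)).prod volume) := by
  have ht : Integrable (fun t : ℝ => t ^ (s.re - 1) * Real.exp (-c ^ 2 * t ^ (1 : ℝ)))
      (volume.restrict (Ioi 0)) :=
    integrableOn_rpow_mul_exp_neg_mul_rpow (by linarith) one_pos (by positivity)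
  refine (ht.mul_prod (integrable_one_div_sq_add_sq hj)).mono'
    (Measurable.aestronglyMeasurable (by fun_prop)) ?_
  have hmem : ∀ᵐ p : ℝ × ℝ ∂(volume.restrict (Ioi 0)).prod volume, 0 < p.1 :=
    Measure.quasiMeasurePreserving_fst.ae (ae_restrict_mem measurableSet_Ioi)
  filter_upwards [hmem] with p hp
  have hw : 0 < p.2 ^ 2 + j ^ 2 := by positivity
  rw [norm_mul, norm_mul, norm_div, Complex.norm_cpow_eq_rpow_re_of_pos hp,
    ← Complex.ofReal_pow, ← Complex.ofReal_pow, ← Complex.ofReal_add,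
    Complex.norm_of_nonneg hw.le, Complex.norm_of_nonneg (Real.exp_pos _).le,
    Complex.norm_of_nonneg (Real.exp_pos _).le, Real.rpow_one, Complex.sub_re, Complex.one_re,
    show -p.1 * c ^ 2 = -c ^ 2 * p.1 by ring]
  gcongr
  exact Real.exp_le_one_iff.2 (by nlinarith [mul_nonneg hp.le (sq_nonneg p.2)])

theorem integral_cpow_mul_exp_mul_exp_div {c j : ℝ} (hc : c ≠ 0) {s : ℂ} (hs : 0 < s.re) (l : ℝ) :
    ∫ t in Ioi (0 : ℝ), (t : ℂ) ^ (s - 1) * (Real.exp (-t * c ^ 2) : ℂ) *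
      ((Real.exp (-t * l ^ 2) : ℂ) / ((l : ℂ) ^ 2 + (j : ℂ) ^ 2)) =
    Complex.Gamma s * (((c ^ 2 + l ^ 2 : ℝ) : ℂ) ^ (-s) / ((l ^ 2 + j ^ 2 : ℝ) : ℂ)) := by
  have hpos : 0 < c ^ 2 + l ^ 2 := by positivity
  have h := Complex.integral_cpow_mul_exp_neg_mul_Ioi hs hpos
  have harg : ((c ^ 2 + l ^ 2 : ℝ) : ℂ).arg ≠ π := by
    rw [Complex.arg_ofReal_of_nonneg hpos.le]
    exact Real.pi_ne_zero.symm
  rw [one_div, Complex.inv_cpow _ _ harg, ← Complex.cpow_neg] at h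
  rw [mul_div_assoc', mul_comm (Complex.Gamma s), ← h, ← integral_div]
  congr 1 with t
  rw [mul_div_assoc', mul_assoc _ (Complex.ofReal _), ← Complex.ofReal_mul, ← Real.exp_add]
  push_cast
  ring_nf

/-- Lemma `Ratcontr` (real-integral form, `j > 0`): the Mellin-type integral
`Z(s) = (j/π) ∫₀^∞ t^{s-1} e^{-tc²} (∫_ℝ e^{-tλ²}/(λ²+j²) dλ) dt` converges absolutely for
`Re s > 0`, and `Z(s)/Γ(s)` extends holomorphically to `Re s > -1/2` with value `1` and
derivative `-2 log(c+j)` at `s = 0`. -/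
theorem stmt6 (c j : ℝ) (hc : 0 < c) (hj : 0 < j) :
    (∀ s : ℂ, 0 < s.re →
      MeasureTheory.IntegrableOn
        (fun t : ℝ => (t : ℂ) ^ (s - 1) * (Real.exp (-t * c ^ 2) : ℂ) *
          ((∫ l : ℝ, Real.exp (-t * l ^ 2) / (l ^ 2 + j ^ 2)) : ℂ))
        (Set.Ioi 0)) ∧
    ∃ g : ℂ → ℂ,
      DifferentiableOn ℂ g {s : ℂ | -1/2 < s.re} ∧
      (∀ s : ℂ, 0 < s.re →
        Complex.Gamma s * g s =
          ((j / Real.pi : ℝ) : ℂ) * ∫ t in Set.Ioi (0:ℝ),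
            (t : ℂ) ^ (s - 1) * (Real.exp (-t * c ^ 2) : ℂ) *
              ((∫ l : ℝ, Real.exp (-t * l ^ 2) / (l ^ 2 + j ^ 2)) : ℂ)) ∧
      g 0 = 1 ∧ deriv g 0 = -2 * Real.log (c + j) := by
  have hderiv := fun (s : ℂ) (hs : -1 / 2 < s.re) =>
    (hasDerivAt_integral_cpow_sq_add_div_sq_add hc.ne' hj.ne' hs).const_mul ((j / π : ℝ) : ℂ)
  refine ⟨fun s hs => ?_, _, fun s hs => (hderiv s hs).differentiableAt.differentiableWithinAt,
    fun s hs => ?_, ?_, ?_⟩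
  · have h := (integrable_cpow_mul_exp_mul_exp_div_prod hc.ne' hj.ne' hs).integral_prod_left
    simp_rw [integral_const_mul] at h
    exact h
  · have h := integral_integral_swap (μ := volume.restrict (Ioi (0 : ℝ))) (ν := volume)
      (f := fun t l : ℝ => (t : ℂ) ^ (s - 1) * (Real.exp (-t * c ^ 2) : ℂ) *
        ((Real.exp (-t * l ^ 2) : ℂ) / ((l : ℂ) ^ 2 + (j : ℂ) ^ 2)))
      (integrable_cpow_mul_exp_mul_exp_div_prod hc.ne' hj.ne' hs)
    simp_rw [integral_cpow_mul_exp_mul_exp_div hc.ne' hs, integral_const_mul] at h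
    rw [h]
    ring
  · have h : ∀ l : ℝ, ((c ^ 2 + l ^ 2 : ℝ) : ℂ) ^ (-0 : ℂ) / ((l ^ 2 + j ^ 2 : ℝ) : ℂ) =
        ((1 / (l ^ 2 + j ^ 2) : ℝ) : ℂ) := fun l => by simp
    simp_rw [h]
    rw [integral_complex_ofReal, integral_one_div_sq_add_sq hj, ← Complex.ofReal_mul,
      div_mul_div_cancel₀ Real.pi_ne_zero, div_self hj.ne', Complex.ofReal_one]
  · rw [(hderiv 0 (by norm_num)).deriv]
    have h : ∀ l : ℝ, -((Real.log (c ^ 2 + l ^ 2) : ℝ) : ℂ) * ((c ^ 2 + l ^ 2 : ℝ) : ℂ) ^ (-0 : ℂ) /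
        ((l ^ 2 + j ^ 2 : ℝ) : ℂ) =
        ((-(Real.log (c ^ 2 + l ^ 2) / (l ^ 2 + j ^ 2)) : ℝ) : ℂ) := fun l => by
      rw [neg_zero, Complex.cpow_zero, mul_one]
      push_cast
      ring
    simp_rw [h]
    rw [integral_complex_ofReal, integral_neg, integral_log_sq_add_div_sq_add hc hj,
      ← Complex.ofReal_mul]
    have : j / π * -(2 * π / j * Real.log (c + j)) = -2 * Real.log (c + j) := by
      field_simp
    rw [this]
    push_cast
    ring
end

section
/- Let ψ(z) := Γ′(z)/Γ(z) denote the digamma function, the logarithmic derivative of the complex Gamma function Γ. Then for every z ∈ ℂ with Re(z) > 0 one has ∫_ℝ ψ(1 + iλ)/(λ² + z²) dλ = (π/z) ψ(1 + z). -/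
open MeasureTheory Real Set

open Filter Topology

/-- Pointwise convergence of uniformly bounded holomorphic functions on a neighbourhood of a closed
ball implies convergence of the derivatives at the centre. -/
lemma tendsto_deriv_of_tendsto_of_bounded {U : Set ℂ} (hU : IsOpen U) {F : ℕ → ℂ → ℂ} {f : ℂ → ℂ}
    {c : ℂ} {r C : ℝ} (hr : 0 < r) (hcU : Metric.closedBall c r ⊆ U)
    (hF : ∀ᶠ n in atTop, DifferentiableOn ℂ (F n) U) (hf : DifferentiableOn ℂ f U)
    (hbound : ∀ᶠ n in atTop, ∀ w ∈ Metric.sphere c r, ‖F n w‖ ≤ C)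
    (hlim : ∀ w ∈ Metric.sphere c r, Tendsto (fun n => F n w) atTop (𝓝 (f w))) :
    Tendsto (fun n => deriv (F n) c) atTop (𝓝 (deriv f c)) := by
  have hmem (θ : ℝ) : circleMap c r θ ∈ Metric.sphere c r := circleMap_mem_sphere c hr.le θ
  have hne (θ : ℝ) : circleMap c r θ - c ≠ 0 := sub_ne_zero.2 (circleMap_ne_center hr.ne')
  have hcont {g : ℂ → ℂ} (hg : DifferentiableOn ℂ g U) : Continuous fun θ => g (circleMap c r θ) :=
    hg.continuousOn.comp_continuous (continuous_circleMap c r)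
      fun θ => hcU (Metric.sphere_subset_closedBall (hmem θ))
  rw [← Complex.cderiv_eq_deriv hU hf hr hcU]
  refine Tendsto.congr' (hF.mono fun n hn => Complex.cderiv_eq_deriv hU hn hr hcU) ?_
  simp only [Complex.cderiv, circleIntegral]
  refine Tendsto.const_smul ?_ _
  refine intervalIntegral.tendsto_integral_filter_of_dominated_convergence
    (fun _ => r * ((r ^ 2)⁻¹ * C)) ?_ ?_ (by simp) ?_
  · filter_upwards [hF] with n hn
    refine Continuous.aestronglyMeasurable ?_
    have h1 := hcont hn
    simp only [deriv_circleMap, smul_eq_mul]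
    have h2 := continuous_circleMap c r
    have h3 := continuous_circleMap 0 r
    exact (by fun_prop : Continuous fun θ => circleMap 0 r θ * Complex.I).mul
      (((by fun_prop : Continuous fun θ => (circleMap c r θ - c) ^ 2).inv₀
        fun θ => pow_ne_zero 2 (hne θ)).mul h1)
  · filter_upwards [hbound] with n hn
    refine Eventually.of_forall fun θ _ => ?_
    have h := hn _ (hmem θ)
    simp only [deriv_circleMap, smul_eq_mul, norm_mul, norm_inv, norm_pow, norm_circleMap_zero,
      Complex.norm_I, mul_one, circleMap_sub_center, abs_of_pos hr]
    gcongr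
  · refine Eventually.of_forall fun θ _ => ?_
    exact ((hlim _ (hmem θ)).const_smul _).const_smul _

lemma norm_GammaSeq_le {s : ℂ} (hs : 0 < s.re) {n : ℕ} (hn : n ≠ 0) :
    ‖Complex.GammaSeq s n‖ ≤ Real.Gamma s.re := by
  have hint := Real.GammaIntegral_convergent hs
  rw [Complex.GammaSeq_eq_approx_Gamma_integral hs hn,
    intervalIntegral.integral_of_le n.cast_nonneg, Real.Gamma_eq_integral hs]
  calc _ ≤ ∫ x in Ioc (0 : ℝ) n, Real.exp (-x) * x ^ (s.re - 1) := by
        refine norm_integral_le_of_norm_le (hint.mono_set Ioc_subset_Ioi_self) ?_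
        filter_upwards [ae_restrict_mem measurableSet_Ioc] with x hx
        rw [norm_mul, Complex.norm_cpow_eq_rpow_re_of_pos hx.1, Complex.norm_real,
          Real.norm_of_nonneg (pow_nonneg (sub_nonneg.2 (div_le_one_of_le₀ hx.2 n.cast_nonneg)) n)]
        exact mul_le_mul_of_nonneg_right (one_sub_div_pow_le_exp_neg hx.2)
          (Real.rpow_nonneg hx.1.le _)
    _ ≤ _ := by
        refine setIntegral_mono_set hint ?_ Ioc_subset_Ioi_self.eventuallyLE
        filter_upwards [ae_restrict_mem measurableSet_Ioi] with x hx
        exact mul_nonneg (Real.exp_nonneg _) (Real.rpow_nonneg hx.le _)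

lemma add_natCast_ne_zero_of_re_pos {s : ℂ} (hs : 0 < s.re) (j : ℕ) : s + j ≠ 0 := fun h => by
  have := congrArg Complex.re h
  simp only [Complex.add_re, Complex.natCast_re, Complex.zero_re] at this
  linarith [(j.cast_nonneg : (0 : ℝ) ≤ j)]

lemma differentiableAt_GammaSeq {s : ℂ} (hs : 0 < s.re) {n : ℕ} (hn : n ≠ 0) :
    DifferentiableAt ℂ (fun s => Complex.GammaSeq s n) s := by
  unfold Complex.GammaSeq
  refine DifferentiableAt.div ?_ (by fun_prop)
    (Finset.prod_ne_zero_iff.2 fun j _ => add_natCast_ne_zero_of_re_pos hs j)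
  exact (differentiableAt_id.const_cpow (Or.inl (Nat.cast_ne_zero.2 hn))).mul_const _

/-- The sequence `log n - ∑_{j ≤ n} 1 / (s + j)`, converging to `ψ(s)`. -/
noncomputable def digammaSeq (s : ℂ) (n : ℕ) : ℂ :=
  Complex.log n - ∑ j ∈ Finset.range (n + 1), 1 / (s + j)

lemma logDeriv_GammaSeq {s : ℂ} (hs : 0 < s.re) {n : ℕ} (hn : n ≠ 0) :
    logDeriv (fun s => Complex.GammaSeq s n) s = digammaSeq s n := by
  have hn' : (n : ℂ) ≠ 0 := Nat.cast_ne_zero.2 hn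
  have hcpow : HasDerivAt (fun s : ℂ => (n : ℂ) ^ s) ((n : ℂ) ^ s * Complex.log n) s := by
    simpa using (hasDerivAt_id s).const_cpow (Or.inl hn')
  have hfact : ((n.factorial : ℕ) : ℂ) ≠ 0 := Nat.cast_ne_zero.2 n.factorial_ne_zero
  have hpow : (n : ℂ) ^ s ≠ 0 := by simp [Complex.cpow_eq_zero_iff, hn']
  unfold Complex.GammaSeq digammaSeq
  rw [logDeriv_div (f := fun s : ℂ => (n : ℂ) ^ s * n.factorial) s (mul_ne_zero hpow hfact)
      (Finset.prod_ne_zero_iff.2 fun j _ => add_natCast_ne_zero_of_re_pos hs j)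
      (hcpow.differentiableAt.mul_const _) (by fun_prop),
    logDeriv_mul_const _ _ hfact, logDeriv_apply, hcpow.deriv, mul_div_cancel_left₀ _ hpow,
    logDeriv_prod (fun j _ => add_natCast_ne_zero_of_re_pos hs j) (by fun_prop)]
  simp [logDeriv_apply]

theorem digammaSeq_tendsto_digamma {s : ℂ} (hs : 0 < s.re) :
    Tendsto (digammaSeq s) atTop (𝓝 (digamma s)) := by
  let U : Set ℂ := {w | 0 < w.re}
  have hU : IsOpen U := isOpen_lt continuous_const Complex.continuous_re
  obtain ⟨r, hr, hrU⟩ := Metric.nhds_basis_closedBall.mem_iff.1 (hU.mem_nhds hs)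
  obtain ⟨C, hC⟩ := (isCompact_closedBall s r).exists_bound_of_continuousOn
    (f := fun w => Real.Gamma w.re) fun w hw =>
      ((Real.differentiableAt_Gamma fun m =>
        ((neg_nonpos.2 m.cast_nonneg).trans_lt (hrU hw)).ne').continuousAt.comp
        Complex.continuous_re.continuousAt).continuousWithinAt
  have hderiv : Tendsto (fun n => deriv (fun s => Complex.GammaSeq s n) s) atTop
      (𝓝 (deriv Complex.Gamma s)) := by
    refine tendsto_deriv_of_tendsto_of_bounded (C := C) hU hr hrU ?_ ?_ ?_
      fun w _ => Complex.GammaSeq_tendsto_Gamma w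
    · filter_upwards [eventually_ne_atTop 0] with n hn w hw
      exact (differentiableAt_GammaSeq hw hn).differentiableWithinAt
    · exact fun w hw => (Complex.differentiableAt_Gamma w fun m h =>
        add_natCast_ne_zero_of_re_pos hw m (by simp [h])).differentiableWithinAt
    · filter_upwards [eventually_ne_atTop 0] with n hn w hw
      have hw' := Metric.sphere_subset_closedBall hw
      exact (norm_GammaSeq_le (hrU hw') hn).trans ((le_abs_self _).trans (hC w hw'))
  refine (hderiv.div (Complex.GammaSeq_tendsto_Gamma s)
    (Complex.Gamma_ne_zero_of_re_pos hs)).congr' ?_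
  filter_upwards [eventually_ne_atTop 0] with n hn
  exact logDeriv_GammaSeq hs hn

lemma add_I_mul_ne_zero {a : ℂ} (ha : 0 < a.re) (x : ℝ) : a + Complex.I * x ≠ 0 := fun h => by
  simpa [ha.ne'] using congrArg Complex.re h

lemma sq_add_sq_eq_mul (z : ℂ) (x : ℝ) :
    (x : ℂ) ^ 2 + z ^ 2 = (z + Complex.I * x) * (z + Complex.I * (-x : ℝ)) := by
  push_cast
  linear_combination (x : ℂ) ^ 2 * Complex.I_sq

lemma exists_norm_inv_add_I_mul_le {a : ℂ} (ha : 0 < a.re) :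
    ∃ C : ℝ, 0 ≤ C ∧ ∀ x : ℝ, ‖(a + Complex.I * x)⁻¹‖ ≤ C * (1 + ‖x‖)⁻¹ := by
  refine ⟨(1 + |a.im|) / a.re + 1, by positivity, fun x => ?_⟩
  have hpos : 0 < ‖a + Complex.I * x‖ := norm_pos_iff.2 (add_I_mul_ne_zero ha x)
  have hre : a.re ≤ ‖a + Complex.I * x‖ := by
    simpa using (a + Complex.I * x).re_le_norm
  have him : ‖x‖ ≤ ‖a + Complex.I * x‖ + |a.im| := by
    have h : |a.im + x| ≤ ‖a + Complex.I * x‖ := by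
      simpa using (a + Complex.I * x).abs_im_le_norm
    rw [Real.norm_eq_abs]
    linarith [abs_sub_abs_le_abs_add x a.im, add_comm x a.im ▸ h]
  have hmul : 1 + |a.im| ≤ (1 + |a.im|) / a.re * ‖a + Complex.I * x‖ := by
    calc 1 + |a.im| = (1 + |a.im|) / a.re * a.re := by field_simp
      _ ≤ _ := by gcongr
  rw [norm_inv, ← div_eq_mul_inv, inv_le_comm₀ hpos (by positivity), inv_div,
    div_le_iff₀ (by positivity)]
  linarith

lemma integrable_const_mul_inv_one_add_norm_sq (C : ℝ) :
    Integrable fun x : ℝ => C * ((1 + ‖x‖) ^ 2)⁻¹ := by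
  have h : Integrable fun x : ℝ => (1 + ‖x‖) ^ (-2 : ℝ) := integrable_one_add_norm (by simp)
  refine (h.const_mul C).congr (Eventually.of_forall fun x => ?_)
  simp only
  rw [Real.rpow_neg (by positivity)]
  norm_num

lemma exists_norm_inv_sq_add_sq_le {z : ℂ} (hz : 0 < z.re) :
    ∃ C : ℝ, 0 ≤ C ∧ ∀ x : ℝ, ‖((x : ℂ) ^ 2 + z ^ 2)⁻¹‖ ≤ C * ((1 + ‖x‖) ^ 2)⁻¹ := by
  obtain ⟨C, hC, h⟩ := exists_norm_inv_add_I_mul_le hz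
  refine ⟨C * C, by positivity, fun x => ?_⟩
  rw [sq_add_sq_eq_mul, mul_inv, norm_mul, sq, mul_inv, mul_mul_mul_comm]
  exact mul_le_mul (h x) (by simpa using h (-x)) (norm_nonneg _) (by positivity)

lemma sq_add_sq_ne_zero {z : ℂ} (hz : 0 < z.re) (x : ℝ) : (x : ℂ) ^ 2 + z ^ 2 ≠ 0 := by
  rw [sq_add_sq_eq_mul]
  exact mul_ne_zero (add_I_mul_ne_zero hz x) (add_I_mul_ne_zero hz (-x))

lemma integrable_inv_sq_add_sq {z : ℂ} (hz : 0 < z.re) :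
    Integrable fun x : ℝ => ((x : ℂ) ^ 2 + z ^ 2)⁻¹ := by
  obtain ⟨C, -, h⟩ := exists_norm_inv_sq_add_sq_le hz
  refine (integrable_const_mul_inv_one_add_norm_sq C).mono' ?_ (Eventually.of_forall h)
  exact (Continuous.inv₀ (by fun_prop) (sq_add_sq_ne_zero hz)).aestronglyMeasurable

lemma integrable_inv_mul_inv_add_I_mul {a b : ℂ} (ha : 0 < a.re) (hb : 0 < b.re) :
    Integrable fun x : ℝ => (a + Complex.I * x)⁻¹ * (b + Complex.I * x)⁻¹ := by
  obtain ⟨C, hC, h⟩ := exists_norm_inv_add_I_mul_le ha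
  obtain ⟨D, hD, h'⟩ := exists_norm_inv_add_I_mul_le hb
  refine (integrable_const_mul_inv_one_add_norm_sq (C * D)).mono' ?_
    (Eventually.of_forall fun x => ?_)
  · exact ((Continuous.inv₀ (by fun_prop) (add_I_mul_ne_zero ha)).mul
      (Continuous.inv₀ (by fun_prop) (add_I_mul_ne_zero hb))).aestronglyMeasurable
  · rw [norm_mul, sq, mul_inv, mul_mul_mul_comm]
    exact mul_le_mul (h x) (h' x) (norm_nonneg _) (by positivity)

lemma tendsto_log_add_mul_sub_log (a : ℂ) {b : ℂ} (hb : b ∈ Complex.slitPlane) :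
    Tendsto (fun x : ℝ => Complex.log (a + b * x) - Real.log x) atTop (𝓝 (Complex.log b)) := by
  have hlim : Tendsto (fun x : ℝ => b + a * ((x⁻¹ : ℝ) : ℂ)) atTop (𝓝 b) := by
    have h := (Complex.continuous_ofReal.tendsto 0).comp tendsto_inv_atTop_zero
    simpa using tendsto_const_nhds.add (h.const_mul a)
  refine ((continuousAt_clog hb).tendsto.comp hlim).congr' ?_
  filter_upwards [eventually_gt_atTop 0,
    hlim.eventually_ne (Complex.slitPlane_ne_zero hb)] with x hx hne
  have hx' : (x : ℂ) ≠ 0 := Complex.ofReal_ne_zero.2 hx.ne'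
  have h : a + b * x = x * (b + a * ((x⁻¹ : ℝ) : ℂ)) := by
    push_cast
    field_simp
    ring
  rw [Function.comp_apply, h, Complex.log_ofReal_mul hx hne]
  ring

lemma tendsto_log_add_I_mul_atTop (a : ℂ) :
    Tendsto (fun x : ℝ => Complex.log (a + Complex.I * x) - Real.log x) atTop
      (𝓝 (π / 2 * Complex.I)) := by
  simpa [Complex.log_I] using
    tendsto_log_add_mul_sub_log a (b := Complex.I) (by simp [Complex.mem_slitPlane_iff])

lemma tendsto_log_add_I_mul_neg_atTop (a : ℂ) :
    Tendsto (fun x : ℝ => Complex.log (a + Complex.I * (-x : ℝ)) - Real.log x) atTop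
      (𝓝 (-(π / 2) * Complex.I)) := by
  simpa [Complex.log_neg_I] using
    tendsto_log_add_mul_sub_log a (b := -Complex.I) (by simp [Complex.mem_slitPlane_iff])

lemma tendsto_atBot_of_comp_neg {f : ℝ → ℂ} {l : ℂ}
    (h : Tendsto (fun x => f (-x)) atTop (𝓝 l)) : Tendsto f atBot (𝓝 l) := by
  simpa [Function.comp_def] using h.comp tendsto_neg_atBot_atTop

lemma hasDerivAt_add_I_mul (a : ℂ) (x : ℝ) :
    HasDerivAt (fun x : ℝ => a + Complex.I * x) Complex.I x := by
  simpa using ((Complex.ofRealCLM.hasDerivAt (x := x)).const_mul Complex.I).const_add a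

lemma hasDerivAt_log_add_I_mul {a : ℂ} (ha : 0 < a.re) (x : ℝ) :
    HasDerivAt (fun x : ℝ => Complex.log (a + Complex.I * x))
      (Complex.I * (a + Complex.I * x)⁻¹) x := by
  have h := (hasDerivAt_add_I_mul a x).clog_real (Or.inl (by simpa using ha))
  simpa [div_eq_mul_inv] using h

theorem integral_inv_ofReal_sq_add_sq {z : ℂ} (hz : 0 < z.re) :
    ∫ x : ℝ, ((x : ℂ) ^ 2 + z ^ 2)⁻¹ = π / z := by
  have hz0 : z ≠ 0 := by rintro rfl; simp at hz
  let f : ℝ → ℂ := fun x =>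
    (2 * Complex.I * z)⁻¹ *
      (Complex.log (z + Complex.I * x) - Complex.log (z + Complex.I * (-x : ℝ)))
  have htop : Tendsto f atTop (𝓝 (π / (2 * z))) := by
    have h := ((tendsto_log_add_I_mul_atTop z).sub
      (tendsto_log_add_I_mul_neg_atTop z)).const_mul (2 * Complex.I * z)⁻¹
    convert h using 2
    · simp only [f]; ring
    · field_simp; ring
  have hbot : Tendsto f atBot (𝓝 (-(π / (2 * z)))) := by
    refine tendsto_atBot_of_comp_neg (htop.neg.congr fun x => ?_)
    simp only [f, neg_neg]; ring
  have hderiv (x : ℝ) : HasDerivAt f ((x : ℂ) ^ 2 + z ^ 2)⁻¹ x := by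
    have h1 := hasDerivAt_log_add_I_mul hz x
    have h2 := (hasDerivAt_log_add_I_mul hz (-x)).scomp x (hasDerivAt_neg x)
    refine ((h1.sub h2).const_mul (2 * Complex.I * z)⁻¹).congr_deriv ?_
    rw [sq_add_sq_eq_mul]
    have hp := add_I_mul_ne_zero hz x
    have hm := add_I_mul_ne_zero hz (-x)
    simp only [neg_smul, one_smul]
    field_simp
    push_cast
    ring
  rw [integral_of_hasDerivAt_of_tendsto hderiv (integrable_inv_sq_add_sq hz) hbot htop]
  field_simp
  ring

theorem integral_inv_mul_inv_add_I_mul {a b : ℂ} (ha : 0 < a.re) (hb : 0 < b.re) :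
    ∫ x : ℝ, (a + Complex.I * x)⁻¹ * (b + Complex.I * x)⁻¹ = 0 := by
  have hint := integrable_inv_mul_inv_add_I_mul ha hb
  rcases eq_or_ne a b with rfl | hab
  · have hderiv (x : ℝ) : HasDerivAt (fun x : ℝ => Complex.I * (a + Complex.I * x)⁻¹)
        ((a + Complex.I * x)⁻¹ * (a + Complex.I * x)⁻¹) x := by
      have hne := add_I_mul_ne_zero ha x
      refine (((hasDerivAt_add_I_mul a x).fun_inv hne).const_mul Complex.I).congr_deriv ?_
      field_simp
      simp
    obtain ⟨C, -, hC⟩ := exists_norm_inv_add_I_mul_le ha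
    have hlim {l : Filter ℝ} (hl : Tendsto (fun x : ℝ => ‖x‖) l atTop) :
        Tendsto (fun x : ℝ => Complex.I * (a + Complex.I * x)⁻¹) l (𝓝 0) := by
      have h0 : Tendsto (fun x : ℝ => C * (1 + ‖x‖)⁻¹) l (𝓝 0) := by
        simpa using (tendsto_inv_atTop_zero.comp
          (tendsto_atTop_add_const_left l 1 hl)).const_mul C
      simpa using (squeeze_zero_norm hC h0).const_mul Complex.I
    simpa using integral_of_hasDerivAt_of_tendsto hderiv hint
      (hlim tendsto_abs_atBot_atTop) (hlim tendsto_abs_atTop_atTop)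
  · have hsub : b - a ≠ 0 := sub_ne_zero.2 hab.symm
    let f : ℝ → ℂ := fun x =>
      (Complex.I * (b - a))⁻¹ *
        (Complex.log (a + Complex.I * x) - Complex.log (b + Complex.I * x))
    have hderiv (x : ℝ) : HasDerivAt f ((a + Complex.I * x)⁻¹ * (b + Complex.I * x)⁻¹) x := by
      refine (((hasDerivAt_log_add_I_mul ha x).sub
        (hasDerivAt_log_add_I_mul hb x)).const_mul (Complex.I * (b - a))⁻¹).congr_deriv ?_
      have h1 := add_I_mul_ne_zero ha x
      have h2 := add_I_mul_ne_zero hb x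
      field_simp
      ring
    have htop : Tendsto f atTop (𝓝 0) := by
      have h := ((tendsto_log_add_I_mul_atTop a).sub
        (tendsto_log_add_I_mul_atTop b)).const_mul (Complex.I * (b - a))⁻¹
      simpa [f] using h
    have hbot : Tendsto f atBot (𝓝 0) := by
      have h := ((tendsto_log_add_I_mul_neg_atTop a).sub
        (tendsto_log_add_I_mul_neg_atTop b)).const_mul (Complex.I * (b - a))⁻¹
      refine tendsto_atBot_of_comp_neg ?_
      simpa [f] using h
    simpa using integral_of_hasDerivAt_of_tendsto hderiv hint hbot htop

lemma inv_add_I_mul_div_sq_add_sq {a z : ℂ} (ha : 0 < a.re) (hz : 0 < z.re) (x : ℝ) :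
    1 / (a + Complex.I * x) / ((x : ℂ) ^ 2 + z ^ 2) =
      (a + z)⁻¹ * ((a + Complex.I * x)⁻¹ * (z + Complex.I * x)⁻¹ + ((x : ℂ) ^ 2 + z ^ 2)⁻¹) := by
  have haz : a + z ≠ 0 := fun h => by
    have := congrArg Complex.re h
    simp only [Complex.add_re, Complex.zero_re] at this
    linarith
  have h1 := add_I_mul_ne_zero ha x
  have h2 := add_I_mul_ne_zero hz x
  have h3 := add_I_mul_ne_zero hz (-x)
  rw [sq_add_sq_eq_mul]
  field_simp
  push_cast
  ring

lemma integrable_inv_add_I_mul_div_sq_add_sq {a z : ℂ} (ha : 0 < a.re) (hz : 0 < z.re) :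
    Integrable fun x : ℝ => 1 / (a + Complex.I * x) / ((x : ℂ) ^ 2 + z ^ 2) := by
  simp_rw [inv_add_I_mul_div_sq_add_sq ha hz]
  exact ((integrable_inv_mul_inv_add_I_mul ha hz).add (integrable_inv_sq_add_sq hz)).const_mul _

theorem integral_inv_add_I_mul_div_sq_add_sq {a z : ℂ} (ha : 0 < a.re) (hz : 0 < z.re) :
    ∫ x : ℝ, 1 / (a + Complex.I * x) / ((x : ℂ) ^ 2 + z ^ 2) = π / z * (1 / (a + z)) := by
  simp_rw [inv_add_I_mul_div_sq_add_sq ha hz]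
  rw [integral_const_mul, integral_add (integrable_inv_mul_inv_add_I_mul ha hz)
    (integrable_inv_sq_add_sq hz), integral_inv_mul_inv_add_I_mul ha hz,
    integral_inv_ofReal_sq_add_sq hz]
  ring
lemma integral_digammaSeq_div_sq_add_sq {z : ℂ} (hz : 0 < z.re) (n : ℕ) :
    ∫ x : ℝ, digammaSeq (1 + Complex.I * x) n / ((x : ℂ) ^ 2 + z ^ 2) =
      π / z * digammaSeq (1 + z) n := by
  have hre (j : ℕ) : 0 < ((1 : ℂ) + j).re := by
    simp only [Complex.add_re, Complex.one_re, Complex.natCast_re]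
    positivity
  have hintegrand (x : ℝ) : digammaSeq (1 + Complex.I * x) n / ((x : ℂ) ^ 2 + z ^ 2) =
      Complex.log n * ((x : ℂ) ^ 2 + z ^ 2)⁻¹ -
        ∑ j ∈ Finset.range (n + 1), 1 / (1 + j + Complex.I * x) / ((x : ℂ) ^ 2 + z ^ 2) := by
    rw [digammaSeq, sub_div, Finset.sum_div, div_eq_mul_inv]
    simp only [add_right_comm]
  have hint (j : ℕ) := integrable_inv_add_I_mul_div_sq_add_sq (hre j) hz
  simp_rw [hintegrand]
  rw [integral_sub ((integrable_inv_sq_add_sq hz).const_mul _)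
      (integrable_finsetSum _ fun j _ => hint j),
    integral_const_mul, integral_inv_ofReal_sq_add_sq hz, integral_finsetSum _ fun j _ => hint j,
    digammaSeq, mul_sub, Finset.mul_sum, mul_comm]
  simp only [integral_inv_add_I_mul_div_sq_add_sq (hre _) hz, add_right_comm 1 z]

lemma norm_inv_sub_inv_add_I_mul_le {k : ℝ} (hk : 0 < k) (x : ℝ) :
    ‖1 / (k : ℂ) - 1 / (k + Complex.I * x)‖ ≤ √‖x‖ * (k ^ (3 / 2 : ℝ))⁻¹ := by
  have hne : (k : ℂ) + Complex.I * x ≠ 0 := add_I_mul_ne_zero (by simpa using hk) x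
  have hk0 : (k : ℂ) ≠ 0 := Complex.ofReal_ne_zero.2 hk.ne'
  have hpos : 0 < ‖(k : ℂ) + Complex.I * x‖ := norm_pos_iff.2 hne
  have hre : k ≤ ‖(k : ℂ) + Complex.I * x‖ := by
    simpa using ((k : ℂ) + Complex.I * x).re_le_norm
  have him : ‖x‖ ≤ ‖(k : ℂ) + Complex.I * x‖ := by
    simpa using ((k : ℂ) + Complex.I * x).abs_im_le_norm
  have hsqrt : √k * √‖x‖ ≤ ‖(k : ℂ) + Complex.I * x‖ := by
    rw [← Real.sqrt_mul hk.le]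
    refine Real.sqrt_le_iff.2 ⟨hpos.le, ?_⟩
    rw [sq]
    exact mul_le_mul hre him (norm_nonneg _) hpos.le
  have hsub : 1 / (k : ℂ) - 1 / (k + Complex.I * x) =
      Complex.I * x / (k * (k + Complex.I * x)) := by
    field_simp
    ring
  have hpow : k ^ (3 / 2 : ℝ) = k * √k := by
    rw [Real.sqrt_eq_rpow, ← Real.rpow_one_add' hk.le (by norm_num)]
    norm_num
  rw [hsub, hpow, norm_div, norm_mul, norm_mul, Complex.norm_I, one_mul, Complex.norm_real,
    Complex.norm_real, Real.norm_of_nonneg hk.le, ← div_eq_mul_inv,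
    div_le_div_iff₀ (by positivity) (by positivity)]
  calc ‖x‖ * (k * √k) = k * √‖x‖ * (√k * √‖x‖) := by
        linear_combination -(k * √k) * Real.mul_self_sqrt (norm_nonneg x)
    _ ≤ k * √‖x‖ * ‖(k : ℂ) + Complex.I * x‖ := by gcongr
    _ = _ := by ring

lemma exists_norm_digammaSeq_one_add_I_mul_le :
    ∃ C : ℝ, 0 ≤ C ∧ ∀ (n : ℕ) (x : ℝ),
      ‖digammaSeq (1 + Complex.I * x) n‖ ≤ C * √(1 + ‖x‖) := by
  obtain ⟨M, hM⟩ := (digammaSeq_tendsto_digamma (s := 1) (by simp)).norm.bddAbove_range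
  replace hM (n : ℕ) : ‖digammaSeq 1 n‖ ≤ M := hM (mem_range_self n)
  have hM0 : 0 ≤ M := (norm_nonneg _).trans (hM 0)
  have hsum : Summable fun j : ℕ => (((j + 1 : ℕ) : ℝ) ^ (3 / 2 : ℝ))⁻¹ :=
    (summable_nat_add_iff 1).2 (Real.summable_nat_rpow_inv.2 (by norm_num))
  set S := ∑' j : ℕ, (((j + 1 : ℕ) : ℝ) ^ (3 / 2 : ℝ))⁻¹
  have hS : 0 ≤ S := tsum_nonneg fun j => by positivity
  refine ⟨M + S, by positivity, fun n x => ?_⟩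
  have hdiff : ‖digammaSeq (1 + Complex.I * x) n - digammaSeq 1 n‖ ≤ √‖x‖ * S := by
    have hrw : digammaSeq (1 + Complex.I * x) n - digammaSeq 1 n =
        ∑ j ∈ Finset.range (n + 1), (1 / (((j + 1 : ℕ) : ℝ) : ℂ) -
          1 / ((((j + 1 : ℕ) : ℝ) : ℂ) + Complex.I * x)) := by
      rw [Finset.sum_sub_distrib, digammaSeq, digammaSeq, sub_sub_sub_cancel_left]
      congr 1 <;> refine Finset.sum_congr rfl fun j _ => ?_ <;> push_cast <;> ring
    rw [hrw]
    calc _ ≤ ∑ j ∈ Finset.range (n + 1), √‖x‖ * (((j + 1 : ℕ) : ℝ) ^ (3 / 2 : ℝ))⁻¹ :=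
          norm_sum_le_of_le _ fun j _ => norm_inv_sub_inv_add_I_mul_le (by positivity) x
      _ ≤ _ := by
          rw [← Finset.mul_sum]
          gcongr
          exact hsum.sum_le_tsum _ fun j _ => by positivity
  have hx : √‖x‖ ≤ √(1 + ‖x‖) := Real.sqrt_le_sqrt (by linarith)
  have h1 : 1 ≤ √(1 + ‖x‖) := Real.one_le_sqrt.2 (by linarith [norm_nonneg x])
  calc _ ≤ ‖digammaSeq 1 n‖ + ‖digammaSeq (1 + Complex.I * x) n - digammaSeq 1 n‖ :=
        norm_le_norm_add_norm_sub' _ _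
    _ ≤ M * 1 + √‖x‖ * S := by rw [mul_one]; exact add_le_add (hM n) hdiff
    _ ≤ M * √(1 + ‖x‖) + √(1 + ‖x‖) * S := by gcongr
    _ = _ := by ring

/-- Key computation in the proof of Lemma `Gammacontr`: for `Re z > 0`,
`∫_ℝ ψ(1+iλ)/(λ²+z²) dλ = (π/z) ψ(1+z)`. -/
theorem stmt9 (z : ℂ) (hz : 0 < z.re) :
    (∫ l : ℝ, digamma (1 + Complex.I * l) / ((l : ℂ) ^ 2 + z ^ 2)) =
      (Real.pi : ℂ) / z * digamma (1 + z) := by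
  obtain ⟨C, hC, hseq⟩ := exists_norm_digammaSeq_one_add_I_mul_le
  obtain ⟨D, hD, hden⟩ := exists_norm_inv_sq_add_sq_le hz
  have hlim : Tendsto
      (fun n => ∫ l : ℝ, digammaSeq (1 + Complex.I * l) n / ((l : ℂ) ^ 2 + z ^ 2)) atTop
      (𝓝 (∫ l : ℝ, digamma (1 + Complex.I * l) / ((l : ℂ) ^ 2 + z ^ 2))) := by
    refine tendsto_integral_of_dominated_convergence
      (fun x => C * D * (1 + ‖x‖) ^ (-(3 / 2) : ℝ)) (fun n => ?_) ?_ (fun n => ?_) ?_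
    · unfold digammaSeq
      exact Measurable.aestronglyMeasurable (by fun_prop)
    · exact (integrable_one_add_norm (by norm_num)).const_mul _
    · refine Eventually.of_forall fun x => ?_
      have hpow : (1 + ‖x‖) ^ (-(3 / 2) : ℝ) = √(1 + ‖x‖) * ((1 + ‖x‖) ^ 2)⁻¹ := by
        rw [Real.sqrt_eq_rpow, ← Real.rpow_natCast, ← Real.rpow_neg (by positivity),
          ← Real.rpow_add (by positivity)]
        norm_num
      rw [div_eq_mul_inv, norm_mul, hpow, mul_mul_mul_comm]
      exact mul_le_mul (hseq n x) (hden x) (norm_nonneg _) (by positivity)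
    · exact Eventually.of_forall fun x => (digammaSeq_tendsto_digamma (by simp)).div_const _
  refine tendsto_nhds_unique hlim ?_
  simp_rw [integral_digammaSeq_div_sq_add_sq hz]
  refine (digammaSeq_tendsto_digamma ?_).const_mul _
  rw [Complex.add_re, Complex.one_re]
  positivity
end

section
/- Let ε > 0 and let f : ℝ → ℂ be Lebesgue integrable. Assume there is a sequence (a_j)_{j≥0} of complex numbers such that the series Σ_{j=0}^∞ a_j λ^j converges absolutely to f(λ) for all real λ with |λ| ≤ 2ε. Then for every N ∈ ℕ there exist constants C > 0 and t₀ > 0 such that | ∫_ℝ e^{−tλ²} f(λ) dλ − Σ_{k=0}^N a_{2k} Γ(k + 1/2) t^{−k−1/2} | ≤ C t^{−N−3/2} for all t ≥ t₀; in other words, ∫_ℝ e^{−tλ²} f(λ) dλ has the asymptotic expansion Σ_{k=0}^∞ a_{2k} Γ(k+1/2) t^{−k−1/2} as t → ∞. -/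
open MeasureTheory Real Set

lemma integrable_pow_mul_exp_neg_mul_sq {t : ℝ} (ht : 0 < t) (j : ℕ) :
    Integrable fun l : ℝ => l ^ j * Real.exp (-t * l ^ 2) := by
  have h := integrable_rpow_mul_exp_neg_mul_sq ht (s := (j : ℝ))
    (lt_of_lt_of_le (by norm_num) j.cast_nonneg)
  simpa only [Real.rpow_natCast] using h

lemma integral_even_pow_mul_exp_neg_mul_sq {t : ℝ} (ht : 0 < t) (k : ℕ) :
    ∫ l : ℝ, l ^ (2 * k) * Real.exp (-t * l ^ 2) =
      Real.Gamma ((k : ℝ) + 1 / 2) * t ^ (-(k : ℝ) - 1 / 2) := by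
  have habs := integral_comp_abs (f := fun l : ℝ => l ^ (2 * k) * Real.exp (-t * l ^ 2))
  simp only [sq_abs, pow_mul] at habs
  have hgam := integral_rpow_mul_exp_neg_mul_rpow (p := 2) (q := ((2 * k : ℕ) : ℝ)) (b := t)
    two_pos (lt_of_lt_of_le (by norm_num) (Nat.cast_nonneg _)) ht
  simp only [Real.rpow_natCast, Real.rpow_two, pow_mul] at hgam
  simp only [pow_mul]
  rw [habs, hgam]
  have h1 : (((2 * k : ℕ) : ℝ) + 1) / 2 = (k : ℝ) + 1 / 2 := by push_cast; ring
  have h2 : -(((2 * k : ℕ) : ℝ) + 1) / 2 = -(k : ℝ) - 1 / 2 := by push_cast; ring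
  rw [h1, h2]
  ring

lemma integral_odd_pow_mul_exp_neg_mul_sq (t : ℝ) (k : ℕ) :
    ∫ l : ℝ, l ^ (2 * k + 1) * Real.exp (-t * l ^ 2) = 0 := by
  have h := integral_neg_eq_self (fun l : ℝ => l ^ (2 * k + 1) * Real.exp (-t * l ^ 2)) volume
  have hodd : Odd (2 * k + 1) := ⟨k, rfl⟩
  simp only [hodd.neg_pow, neg_sq, neg_mul, integral_neg] at h
  simp only [neg_mul]
  linarith

lemma integrable_const_mul_pow_mul_exp_neg_mul_sq {t : ℝ} (ht : 0 < t) (c : ℂ) (j : ℕ) :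
    Integrable fun l : ℝ => c * ((l ^ j * Real.exp (-t * l ^ 2) : ℝ) : ℂ) :=
  Integrable.const_mul (integrable_pow_mul_exp_neg_mul_sq ht j).ofReal c

lemma exp_neg_mul_sq_mul_polynomial (t l : ℝ) (a : ℕ → ℂ) (m : ℕ) :
    (Real.exp (-t * l ^ 2) : ℂ) * ∑ j ∈ Finset.range m, a j * (l : ℂ) ^ j =
      ∑ j ∈ Finset.range m, a j * ((l ^ j * Real.exp (-t * l ^ 2) : ℝ) : ℂ) := by
  rw [Finset.mul_sum]
  refine Finset.sum_congr rfl fun j _ => ?_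
  push_cast
  ring

lemma integral_exp_neg_mul_sq_mul_polynomial {t : ℝ} (ht : 0 < t) (a : ℕ → ℂ) (n : ℕ) :
    ∫ l : ℝ, (Real.exp (-t * l ^ 2) : ℂ) * ∑ j ∈ Finset.range (2 * n), a j * (l : ℂ) ^ j =
      ∑ k ∈ Finset.range n, a (2 * k) * (Real.Gamma ((k : ℝ) + 1 / 2) : ℂ) *
        ((t ^ (-(k : ℝ) - 1 / 2) : ℝ) : ℂ) := by
  simp only [exp_neg_mul_sq_mul_polynomial]
  rw [integral_finsetSum _ fun j _ => integrable_const_mul_pow_mul_exp_neg_mul_sq ht (a j) j]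
  simp only [integral_const_mul, integral_complex_ofReal]
  induction n with
  | zero => simp
  | succ n ih =>
    rw [Finset.sum_range_succ _ n, mul_add, mul_one, Finset.sum_range_succ,
      Finset.sum_range_succ, ih, integral_even_pow_mul_exp_neg_mul_sq ht,
      integral_odd_pow_mul_exp_neg_mul_sq]
    push_cast
    ring

/-- The Taylor remainder of order `m` is `O(|x|^m)` on the whole line, up to the function itself
outside the disc of convergence. -/
lemma norm_sub_taylor_le {r : ℝ} (hr : 0 < r) {f : ℝ → ℂ} {a : ℕ → ℂ}
    (hsum : Summable fun j => ‖a j‖ * r ^ j)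
    (hf : ∀ x : ℝ, |x| ≤ r → HasSum (fun j => a j * (x : ℂ) ^ j) (f x)) (m : ℕ) (x : ℝ) :
    ‖f x - ∑ j ∈ Finset.range m, a j * (x : ℂ) ^ j‖ ≤
      (∑' j, ‖a j‖ * r ^ j) * (|x| / r) ^ m + {y : ℝ | r < |y|}.indicator (fun y => ‖f y‖) x := by
  have hnorm (j : ℕ) : ‖a j * (x : ℂ) ^ j‖ = ‖a j‖ * r ^ j * (|x| / r) ^ j := by
    rw [norm_mul, norm_pow, Complex.norm_real, Real.norm_eq_abs, div_pow]
    field_simp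
  have hnn (j : ℕ) : 0 ≤ ‖a j‖ * r ^ j := by positivity
  rcases le_or_gt |x| r with hx | hx
  · rw [Set.indicator_of_notMem (by simpa using hx), add_zero]
    have hq : |x| / r ≤ 1 := (div_le_one hr).2 hx
    have htail := (hasSum_nat_add_iff' m).2 (hf x hx)
    rw [← htail.tsum_eq]
    have hs : Summable fun j => ‖a (j + m)‖ * r ^ (j + m) := (summable_nat_add_iff m).2 hsum
    calc ‖∑' j, a (j + m) * (x : ℂ) ^ (j + m)‖
        ≤ ∑' j, ‖a (j + m)‖ * r ^ (j + m) * (|x| / r) ^ m := by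
          refine tsum_of_norm_bounded (hs.mul_right _).hasSum fun j => ?_
          rw [hnorm]
          exact mul_le_mul_of_nonneg_left
            (pow_le_pow_of_le_one (by positivity) hq (Nat.le_add_left m j)) (hnn _)
      _ = (∑' j, ‖a (j + m)‖ * r ^ (j + m)) * (|x| / r) ^ m := tsum_mul_right
      _ ≤ (∑' j, ‖a j‖ * r ^ j) * (|x| / r) ^ m := by
          refine mul_le_mul_of_nonneg_right ?_ (by positivity)
          rw [← hsum.sum_add_tsum_nat_add m]
          exact le_add_of_nonneg_left (Finset.sum_nonneg fun j _ => hnn j)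
  · rw [Set.indicator_of_mem (by simpa using hx), add_comm]
    refine (norm_sub_le _ _).trans (add_le_add le_rfl ?_)
    have hq : 1 ≤ |x| / r := (one_le_div hr).2 hx.le
    calc ‖∑ j ∈ Finset.range m, a j * (x : ℂ) ^ j‖
        ≤ ∑ j ∈ Finset.range m, ‖a j‖ * r ^ j * (|x| / r) ^ m := by
          refine norm_sum_le_of_le _ fun j hj => ?_
          rw [hnorm]
          exact mul_le_mul_of_nonneg_left
            (pow_le_pow_right₀ hq (Finset.mem_range.1 hj).le) (hnn _)
      _ = (∑ j ∈ Finset.range m, ‖a j‖ * r ^ j) * (|x| / r) ^ m := by rw [Finset.sum_mul]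
      _ ≤ (∑' j, ‖a j‖ * r ^ j) * (|x| / r) ^ m :=
          mul_le_mul_of_nonneg_right (hsum.sum_le_tsum _ fun j _ => hnn j) (by positivity)

lemma exp_neg_mul_le_rpow {c t s : ℝ} (hc : 0 < c) (ht : 1 ≤ t) {n : ℕ} (hs : s ≤ n) :
    Real.exp (-t * c) ≤ n.factorial / c ^ n * t ^ (-s) := by
  have ht0 : 0 < t := by linarith
  have hpow : t ^ s ≤ t ^ n := by
    rw [← Real.rpow_natCast]
    exact Real.rpow_le_rpow_of_exponent_le ht hs
  have hexp := Real.pow_div_factorial_le_exp (t * c) (by positivity) n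
  have hfac : (0 : ℝ) < n.factorial := by exact_mod_cast n.factorial_pos
  rw [neg_mul, Real.exp_neg, Real.rpow_neg ht0.le, inv_le_comm₀ (Real.exp_pos _) (by positivity)]
  refine le_trans ?_ hexp
  rw [mul_inv, inv_inv, inv_div, mul_pow]
  calc c ^ n / n.factorial * t ^ s ≤ c ^ n / n.factorial * t ^ n :=
        mul_le_mul_of_nonneg_left hpow (by positivity)
    _ = t ^ n * c ^ n / n.factorial := by ring

/-- Lemma `asympexp3` (analytic content): if `f : ℝ → ℂ` is integrable and equals an
absolutely convergent power series `Σ a_j λ^j` on `|λ| ≤ 2ε`, then `∫_ℝ e^{-tλ²} f(λ) dλ`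
has the asymptotic expansion `Σ_k a_{2k} Γ(k+1/2) t^{-k-1/2}` as `t → ∞`. -/
theorem stmt12 (ε : ℝ) (hε : 0 < ε) (f : ℝ → ℂ) (hf : MeasureTheory.Integrable f)
    (a : ℕ → ℂ)
    (hconv : ∀ l : ℝ, |l| ≤ 2 * ε →
      Summable (fun j : ℕ => ‖a j * (l : ℂ) ^ j‖) ∧
      HasSum (fun j : ℕ => a j * (l : ℂ) ^ j) (f l)) :
    ∀ N : ℕ, ∃ C : ℝ, 0 < C ∧ ∃ t₀ : ℝ, 0 < t₀ ∧ ∀ t : ℝ, t₀ ≤ t →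
      ‖(∫ l : ℝ, (Real.exp (-t * l ^ 2) : ℂ) * f l) -
        ∑ k ∈ Finset.range (N+1), a (2*k) * (Real.Gamma ((k:ℝ) + 1/2) : ℂ) *
          ((t ^ (-(k:ℝ) - 1/2) : ℝ) : ℂ)‖ ≤ C * t ^ (-(N:ℝ) - 3/2) := by
  intro N
  have hr : 0 < 2 * ε := by positivity
  generalize 2 * ε = r at hr hconv
  have hsum : Summable fun j => ‖a j‖ * r ^ j := by
    simpa [abs_of_pos hr] using (hconv r (abs_of_pos hr).le).1
  have hg := norm_sub_taylor_le hr hsum (fun x hx => (hconv x hx).2) (2 * (N + 1))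
  set S := ∑' j, ‖a j‖ * r ^ j
  have hS : 0 ≤ S := tsum_nonneg fun j => by positivity
  set A := S / r ^ (2 * (N + 1)) * Real.Gamma (((N + 1 : ℕ) : ℝ) + 1 / 2)
  set B := ((N + 2).factorial : ℝ) / (r ^ 2) ^ (N + 2) * ∫ l, ‖f l‖
  have hA : 0 ≤ A := mul_nonneg (by positivity) (Real.Gamma_pos_of_pos (by positivity)).le
  have hB : 0 ≤ B := mul_nonneg (by positivity) (integral_nonneg fun _ => norm_nonneg _)
  refine ⟨A + B + 1, by positivity, 1, one_pos, fun t ht => ?_⟩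
  have ht0 : 0 < t := by linarith
  have hexp_le_one (l : ℝ) : Real.exp (-t * l ^ 2) ≤ 1 := by
    rw [Real.exp_le_one_iff, neg_mul]
    exact neg_nonpos.2 (by positivity)
  have hfint : Integrable fun l : ℝ => (Real.exp (-t * l ^ 2) : ℂ) * f l := by
    refine hf.bdd_mul (c := 1) (by fun_prop) (.of_forall fun l => ?_)
    rw [Complex.norm_real, Real.norm_of_nonneg (Real.exp_pos _).le]
    exact hexp_le_one l
  have hPint : Integrable fun l : ℝ => (Real.exp (-t * l ^ 2) : ℂ) *
      ∑ j ∈ Finset.range (2 * (N + 1)), a j * (l : ℂ) ^ j := by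
    simp only [exp_neg_mul_sq_mul_polynomial]
    exact integrable_finsetSum _ fun j _ =>
      integrable_const_mul_pow_mul_exp_neg_mul_sq ht0 (a j) j
  rw [← integral_exp_neg_mul_sq_mul_polynomial ht0, ← integral_sub hfint hPint]
  have hMint := (integrable_pow_mul_exp_neg_mul_sq ht0 (2 * (N + 1))).const_mul
    (S / r ^ (2 * (N + 1)))
  have hTint := hf.norm.const_mul (Real.exp (-t * r ^ 2))
  refine (norm_integral_le_of_norm_le (hMint.add hTint) (.of_forall fun l => ?_)).trans ?_
  · rw [← mul_sub, norm_mul, Complex.norm_real, Real.norm_of_nonneg (Real.exp_pos _).le]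
    refine (mul_le_mul_of_nonneg_left (hg l) (Real.exp_pos _).le).trans ?_
    rw [mul_add]
    refine add_le_add (le_of_eq ?_) ?_
    · rw [div_pow, (even_two_mul (N + 1)).pow_abs]
      ring
    · by_cases hl : r < |l|
      · rw [Set.indicator_of_mem (by simpa using hl)]
        refine mul_le_mul_of_nonneg_right (Real.exp_le_exp.2 ?_) (norm_nonneg _)
        have : r ^ 2 ≤ l ^ 2 := by
          rw [← sq_abs l]
          gcongr
        nlinarith
      · rw [Set.indicator_of_notMem (by simpa using hl), mul_zero]
        positivity
  · simp only [Pi.add_apply]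
    rw [integral_add hMint hTint, integral_const_mul, integral_const_mul,
      integral_even_pow_mul_exp_neg_mul_sq ht0]
    have hexpo : -((N + 1 : ℕ) : ℝ) - 1 / 2 = -(N : ℝ) - 3 / 2 := by push_cast; ring
    have hdecay := exp_neg_mul_le_rpow (s := (N : ℝ) + 3 / 2) (n := N + 2) (pow_pos hr 2) ht
      (by push_cast; linarith)
    rw [show -((N : ℝ) + 3 / 2) = -(N : ℝ) - 3 / 2 by ring] at hdecay
    have hTail := mul_le_mul_of_nonneg_right hdecay
      (integral_nonneg (μ := volume) fun l => norm_nonneg (f l))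
    have hpos : 0 ≤ t ^ (-(N : ℝ) - 3 / 2) := by positivity
    rw [hexpo]
    calc _ ≤ A * t ^ (-(N : ℝ) - 3 / 2) + B * t ^ (-(N : ℝ) - 3 / 2) := by
          refine add_le_add (le_of_eq (by ring)) (hTail.trans (le_of_eq (by ring)))
      _ ≤ _ := by linarith
end
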